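/- arXiv:2010.11756 — 3 statements merged into one kernel-verified Lean document; each statement's English description precedes it below -/
import Mathlib

section
/- For the four-digit Kaprekar function one has M_2 = 1, M_4 = 3, M_5 = 4, M_10 = 7, and M_20 = 10. -/
/-- The four base-`b` digits of `x` (viewed as a 4-digit string with leading
zeros allowed), sorted in decreasing order. -/
def sortedDigits (b x : ℕ) : List ℕ :=
  List.insertionSort (· ≥ ·) [x % b, x / b % b, x / b ^ 2 % b, x / b ^ 3 % b]

/-- The 4-digit base-`b` Kaprekar function `K_b(x) = D - A`. -/
def Kap (b x : ℕ) : ℕ :=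
  let l := sortedDigits b x
  (l[0]! * b ^ 3 + l[1]! * b ^ 2 + l[2]! * b + l[3]!) -
    (l[3]! * b ^ 3 + l[2]! * b ^ 2 + l[1]! * b + l[0]!)

/-- The difference pair `(a₃ - a₀, a₂ - a₁)` of a 4-digit base-`b` input. -/
def diffPair (b x : ℕ) : ℕ × ℕ :=
  let l := sortedDigits b x
  (l[0]! - l[3]!, l[1]! - l[2]!)

/-- `S_b`: the set of 4-digit base-`b` inputs whose sequence of Kaprekar
iterates is eventually constant and nonzero. -/
def KapSet (b : ℕ) : Set ℕ :=
  {x | x < b ^ 4 ∧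
    ∃ t, (∀ s, t ≤ s → (Kap b)^[s] x = (Kap b)^[t] x) ∧ (Kap b)^[t] x ≠ 0}

/-- Arrange the two coordinates of a pair in decreasing order. -/
def sort2 (p : ℕ × ℕ) : ℕ × ℕ := (max p.1 p.2, min p.1 p.2)

/-- A base-`b` difference pair: `b - 1 ≥ d ≥ d' ≥ 0`. -/
def IsDiffPair (b : ℕ) (p : ℕ × ℕ) : Prop := p.2 ≤ p.1 ∧ p.1 ≤ b - 1

/-- The Kaprekar map on base-`b` difference pairs. -/
def Kpair (b : ℕ) (p : ℕ × ℕ) : ℕ × ℕ :=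
  if p.1 = 0 ∧ p.2 = 0 then (0, 0)
  else if p.2 = 0 then
    -- type (c)
    sort2 (p.1 - 1, b - p.1)
  else if p.1 = p.2 ∨ p.1 + p.2 = b then
    -- type (b)
    sort2 ((2 * (p.1 : ℤ) - ((b : ℤ) - 1)).natAbs,
           (2 * (p.1 : ℤ) - ((b : ℤ) + 1)).natAbs)
  else
    -- type (a)
    sort2 ((2 * (p.1 : ℤ) - (b : ℤ)).natAbs, (2 * (p.2 : ℤ) - (b : ℤ)).natAbs)

theorem sortedDigits_eq {b : ℕ} (hb : 0 < b) (x : ℕ) :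
    ∃ p q r s, sortedDigits b x = [p, q, r, s] ∧ s ≤ r ∧ r ≤ q ∧ q ≤ p ∧ p < b := by
  have hperm := List.perm_insertionSort (· ≥ ·)
    [x % b, x / b % b, x / b ^ 2 % b, x / b ^ 3 % b]
  have hsort := List.pairwise_insertionSort (· ≥ ·)
    [x % b, x / b % b, x / b ^ 2 % b, x / b ^ 3 % b]
  change (sortedDigits b x).Perm _ at hperm
  change (sortedDigits b x).Pairwise _ at hsort
  obtain ⟨p, q, r, s, h⟩ := List.length_eq_four.mp hperm.length_eq
  rw [h] at hperm hsort
  have hp : p ∈ [x % b, x / b % b, x / b ^ 2 % b, x / b ^ 3 % b] :=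
    hperm.subset List.mem_cons_self
  refine ⟨p, q, r, s, h, ?_, ?_, ?_, ?_⟩
  iterate 3 simp_all
  simp only [List.mem_cons, List.not_mem_nil, or_false] at hp
  rcases hp with rfl | rfl | rfl | rfl <;> exact Nat.mod_lt _ hb

/-- A value of the Kaprekar function depends only on the difference pair of its argument. -/
theorem exists_Kap_eq {b : ℕ} (hb : 0 < b) (x : ℕ) :
    ∃ d < b, ∃ e ≤ d, Kap b x = d * (b ^ 3 - 1) + e * (b ^ 2 - b) := by
  obtain ⟨p, q, r, s, h, hsr, hrq, hqp, hpb⟩ := sortedDigits_eq hb x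
  refine ⟨p - s, by omega, q - r, by omega, ?_⟩
  obtain ⟨d, rfl⟩ := Nat.exists_eq_add_of_le (hsr.trans (hrq.trans hqp))
  obtain ⟨e, rfl⟩ := Nat.exists_eq_add_of_le hrq
  obtain ⟨c, rfl⟩ := Nat.exists_eq_add_of_le' hb
  have h3 : (c + 1) ^ 3 - 1 = c ^ 3 + 3 * c ^ 2 + 3 * c :=
    Nat.sub_eq_of_eq_add (by ring)
  have h2 : (c + 1) ^ 2 - (c + 1) = c ^ 2 + c := Nat.sub_eq_of_eq_add (by ring)
  simp only [Kap, h, h2, h3, Nat.add_sub_cancel_left]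
  exact Nat.sub_eq_of_eq_add (by simp; ring)

/-- A periodic point whose orbit is eventually constant is a fixed point. -/
theorem apply_eq_of_periodic_of_eventually_const {f : ℕ → ℕ} {L k t x : ℕ} (hL : 0 < L)
    (hper : f^[L] (f^[k] x) = f^[k] x) (ht : ∀ s, t ≤ s → f^[s] x = f^[t] x) :
    f^[k] x = f^[k + 1] x := by
  have hret : f^[L * t + k] x = f^[k] x := by
    rw [Function.iterate_add_apply]
    exact (show Function.IsPeriodicPt f L (f^[k] x) from hper).mul_const t
  have hle : t ≤ L * t + k := (Nat.le_mul_of_pos_left t hL).trans (Nat.le_add_right _ _)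
  calc f^[k] x = f^[L * t + k] x := hret.symm
    _ = f^[L * t + k + 1] x := (ht _ hle).trans (ht _ (hle.trans (Nat.le_succ _))).symm
    _ = f^[k + 1] x := by rw [Function.iterate_succ_apply', hret, Function.iterate_succ_apply']

/-- Bases in which every Kaprekar value is periodic of period `L` after `k` steps, and some input
reaches a nonzero fixed point after exactly `k + 1` steps. -/
theorem isLeast_Kap_of_periodic {b L k : ℕ} (hb : 0 < b) (hL : 0 < L)
    (hper : ∀ d < b, ∀ e ≤ d,
      (Kap b)^[L] ((Kap b)^[k] (d * (b ^ 3 - 1) + e * (b ^ 2 - b))) =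
        (Kap b)^[k] (d * (b ^ 3 - 1) + e * (b ^ 2 - b)))
    (w : ℕ) (hw : w < b ^ 4) (hfix : Kap b ((Kap b)^[k + 1] w) = (Kap b)^[k + 1] w)
    (hne : (Kap b)^[k + 1] w ≠ 0) (hlt : (Kap b)^[k] w ≠ (Kap b)^[k + 1] w) :
    IsLeast {m : ℕ | ∀ x ∈ KapSet b, (Kap b)^[m] x = (Kap b)^[m + 1] x} (k + 1) := by
  constructor
  · rintro x ⟨-, t, ht, -⟩
    obtain ⟨d, hd, e, he, hx⟩ := exists_Kap_eq hb x
    refine apply_eq_of_periodic_of_eventually_const hL ?_ ht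
    rw [Function.iterate_succ_apply, hx]
    exact hper d hd e he
  · intro m hm
    have hmem : w ∈ KapSet b := by
      refine ⟨hw, k + 1, fun s hs ↦ ?_, hne⟩
      obtain ⟨j, rfl⟩ := Nat.exists_eq_add_of_le' hs
      rw [Function.iterate_add_apply]
      exact Function.iterate_fixed hfix j
    by_contra! hlt'
    have hmw : Kap b ((Kap b)^[m] w) = (Kap b)^[m] w := by
      rw [← Function.iterate_succ_apply' (Kap b)]
      exact (hm w hmem).symm
    obtain ⟨j, rfl⟩ := Nat.exists_eq_add_of_le' (Nat.le_of_lt_succ hlt')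
    apply hlt
    rw [Function.iterate_succ_apply', Function.iterate_add_apply, Function.iterate_fixed hmw, hmw]


/-- `M_2 = 1`, `M_4 = 3`, `M_5 = 4`, `M_10 = 7`, `M_20 = 10`. -/
theorem kaprekar_M_small_bases :
    IsLeast {m : ℕ | ∀ x ∈ KapSet 2, (Kap 2)^[m] x = (Kap 2)^[m + 1] x} 1 ∧
    IsLeast {m : ℕ | ∀ x ∈ KapSet 4, (Kap 4)^[m] x = (Kap 4)^[m + 1] x} 3 ∧
    IsLeast {m : ℕ | ∀ x ∈ KapSet 5, (Kap 5)^[m] x = (Kap 5)^[m + 1] x} 4 ∧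
    IsLeast {m : ℕ | ∀ x ∈ KapSet 10, (Kap 10)^[m] x = (Kap 10)^[m + 1] x} 7 ∧
    IsLeast {m : ℕ | ∀ x ∈ KapSet 20, (Kap 20)^[m] x = (Kap 20)^[m + 1] x} 10 := by
  refine ⟨isLeast_Kap_of_periodic (k := 0) (L := 1) ?_ ?_ ?_ 1 ?_ ?_ ?_ ?_,
    isLeast_Kap_of_periodic (k := 2) (L := 2) ?_ ?_ ?_ 10 ?_ ?_ ?_ ?_,
    isLeast_Kap_of_periodic (k := 3) (L := 1) ?_ ?_ ?_ 3 ?_ ?_ ?_ ?_,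
    isLeast_Kap_of_periodic (k := 6) (L := 1) ?_ ?_ ?_ 14 ?_ ?_ ?_ ?_,
    isLeast_Kap_of_periodic (k := 9) (L := 6) ?_ ?_ ?_ 25 ?_ ?_ ?_ ?_⟩ <;> decide +kernel
end

section
/- If b = 5m·2^n for some odd integer m > 1 and some integer n ≥ 0, then the cardinality of S_b equals 40·4^n·m^2·(1 + 5·4^n); equivalently, |S_b|/b^4 = (8 + 40·4^n)/(5·b^2) = 8/(5·b^2) + 8/(25·m^2). -/
open Finset

/-- The difference pair of four digits given in any order. -/
def digitPair (w x y z : ℕ) : ℕ × ℕ :=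
  let l := List.insertionSort (· ≥ ·) [w, x, y, z]
  (l[0]! - l[3]!, l[1]! - l[2]!)

/-- The number with base-`b` digits `z y x w`. -/
def ofDigits4 (b w x y z : ℕ) : ℕ := w + b * (x + b * (y + b * z))

theorem digits_ofDigits4 {b w x y z : ℕ} (hw : w < b) (hx : x < b) (hy : y < b) (hz : z < b) :
    ofDigits4 b w x y z % b = w ∧ ofDigits4 b w x y z / b % b = x ∧
      ofDigits4 b w x y z / b ^ 2 % b = y ∧ ofDigits4 b w x y z / b ^ 3 % b = z := by
  have hb : 0 < b := by omega
  have h : ∀ {u v : ℕ}, u < b → (u + b * v) / b = v := fun {u v} hu => by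
    rw [Nat.add_mul_div_left _ _ hb, Nat.div_eq_of_lt hu, zero_add]
  have h' : ∀ {u v : ℕ}, u < b → (u + b * v) % b = u := fun {u v} hu => by
    rw [Nat.add_mul_mod_self_left, Nat.mod_eq_of_lt hu]
  refine ⟨h' hw, ?_, ?_, ?_⟩
  · rw [ofDigits4, h hw, h' hx]
  · rw [pow_two, ← Nat.div_div_eq_div_mul, ofDigits4, h hw, h hx, h' hy]
  · rw [pow_succ, pow_two, ← Nat.div_div_eq_div_mul, ← Nat.div_div_eq_div_mul, ofDigits4, h hw,
      h hx, h hy, Nat.mod_eq_of_lt hz]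

theorem ofDigits4_digits (b x : ℕ) (hx : x < b ^ 4) :
    ofDigits4 b (x % b) (x / b % b) (x / b ^ 2 % b) (x / b ^ 3 % b) = x := by
  have h3 : x / b ^ 3 % b = x / b / b / b := by
    rw [Nat.mod_eq_of_lt]
    · rw [pow_succ, pow_two, ← Nat.div_div_eq_div_mul, ← Nat.div_div_eq_div_mul]
    · exact Nat.div_lt_of_lt_mul (by rw [← pow_succ]; exact hx)
  rw [h3, pow_two, ← Nat.div_div_eq_div_mul, ofDigits4, Nat.mod_add_div, Nat.mod_add_div,
    Nat.mod_add_div]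

theorem ofDigits4_lt {b w x y z : ℕ} (hw : w < b) (hx : x < b) (hy : y < b) (hz : z < b) :
    ofDigits4 b w x y z < b ^ 4 := by
  have h : ∀ {u v B : ℕ}, u < b → v < B → u + b * v < b * B := fun {u v B} hu hv => by
    nlinarith [Nat.mul_le_mul_left b (Nat.succ_le_of_lt hv)]
  have := h hw (h hx (h hy hz))
  calc _ < _ := this
    _ = _ := by ring

theorem diffPair_ofDigits4 {b w x y z : ℕ} (hw : w < b) (hx : x < b) (hy : y < b) (hz : z < b) :
    diffPair b (ofDigits4 b w x y z) = digitPair w x y z := by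
  obtain ⟨h0, h1, h2, h3⟩ := digits_ofDigits4 hw hx hy hz
  rw [diffPair, sortedDigits, h0, h1, h2, h3, digitPair]

theorem digitPair_perm {w x y z w' x' y' z' : ℕ} (h : [w, x, y, z].Perm [w', x', y', z']) :
    digitPair w x y z = digitPair w' x' y' z' := by
  have : List.insertionSort (· ≥ ·) [w, x, y, z] = List.insertionSort (· ≥ ·) [w', x', y', z'] :=
    (((List.perm_insertionSort _ _).trans h).trans
      (List.perm_insertionSort _ _).symm).eq_of_pairwise
      (fun _ _ _ _ h₁ h₂ => le_antisymm h₂ h₁) (List.pairwise_insertionSort _ _)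
      (List.pairwise_insertionSort _ _)
  rw [digitPair, this, digitPair]

theorem digitPair_of_ge {w x y z : ℕ} (h : x ≤ w) (h' : y ≤ x) (h'' : z ≤ y) :
    digitPair w x y z = (w - z, x - y) := by
  have : List.insertionSort (· ≥ ·) [w, x, y, z] = [w, x, y, z] := 
    List.Pairwise.insertionSort_eq (by simp; omega)
  rw [digitPair, this]; rfl

/-- Four numbers can be sorted. -/
theorem exists_sorted_perm (w x y z : ℕ) :
    ∃ p q r s, List.insertionSort (· ≥ ·) [w, x, y, z] = [p, q, r, s] ∧
      [w, x, y, z].Perm [p, q, r, s] ∧ q ≤ p ∧ r ≤ q ∧ s ≤ r := by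
  have hp := List.perm_insertionSort (· ≥ ·) [w, x, y, z]
  have hs := List.pairwise_insertionSort (· ≥ ·) [w, x, y, z]
  have hl := hp.length_eq
  generalize List.insertionSort (· ≥ ·) [w, x, y, z] = l at *
  match l, hl with
  | [p, q, r, s], _ => 
    simp at hs
    exact ⟨p, q, r, s, rfl, hp.symm, hs.1.1, hs.2.1.1, hs.2.2⟩

theorem Kap_eq {b x : ℕ} (hb : 0 < b) : IsDiffPair b (diffPair b x) ∧
    Kap b x + (diffPair b x).1 + (diffPair b x).2 * b =
      (diffPair b x).1 * b ^ 3 + (diffPair b x).2 * b ^ 2 := by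
  obtain ⟨p, q, r, s, h, hperm, h1, h2, h3⟩ :=
    exists_sorted_perm (x % b) (x / b % b) (x / b ^ 2 % b) (x / b ^ 3 % b)
  have hpb : p < b := by
    have : p ∈ [x % b, x / b % b, x / b ^ 2 % b, x / b ^ 3 % b] := hperm.mem_iff.2 (by simp)
    simp at this
    rcases this with h | h | h | h <;> rw [h] <;> exact Nat.mod_lt _ hb
  have hd : diffPair b x = (p - s, q - r) := by rw [diffPair, sortedDigits, h]; rfl
  have hk : Kap b x =
      (p * b ^ 3 + q * b ^ 2 + r * b + s) - (s * b ^ 3 + r * b ^ 2 + q * b + p) := by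
    rw [Kap, sortedDigits, h]; rfl
  obtain ⟨k, rfl⟩ := Nat.exists_eq_add_of_le h3
  obtain ⟨l, rfl⟩ := Nat.exists_eq_add_of_le h2
  obtain ⟨j, rfl⟩ := Nat.exists_eq_add_of_le h1
  constructor
  · rw [hd]; constructor <;> dsimp only <;> omega
  rw [hd, hk]
  have e1 : s + k + l + j - s = k + l + j := by omega
  have e2 : s + k + l - (s + k) = l := by omega
  simp only [e1, e2]
  have hb1 : b ≤ b ^ 3 := Nat.le_self_pow (by norm_num) b
  have hb2 : b ≤ b ^ 2 := Nat.le_self_pow (by norm_num) b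
  have hb3 : 1 ≤ b ^ 3 := Nat.one_le_pow _ _ hb
  have : (s * b ^ 3 + (s + k) * b ^ 2 + (s + k + l) * b + (s + k + l + j)) ≤
    ((s + k + l + j) * b ^ 3 + (s + k + l) * b ^ 2 + (s + k) * b + s) := by
    nlinarith [Nat.mul_le_mul_left (k + l + j) hb3, Nat.mul_le_mul_left l hb2]
  zify [this]
  ring

theorem Kap_eq_ofDigits4 {b d e x : ℕ} (hde : e ≤ d) (hd : d < b) (he : 0 < e)
    (h : diffPair b x = (d, e)) : Kap b x = ofDigits4 b (b - d) (b - 1 - e) (e - 1) d := by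
  have := (Kap_eq (x := x) (b := b) (by omega)).2
  rw [h] at this
  obtain ⟨k, rfl⟩ := Nat.exists_eq_add_of_le hde
  obtain ⟨l, rfl⟩ := Nat.exists_eq_add_of_lt hd
  obtain ⟨j, rfl⟩ := Nat.exists_eq_add_of_lt he
  simp only [zero_add] at *
  have e1 : j + 1 + k + l + 1 - (j + 1 + k) = l + 1 := by omega
  have e2 : j + 1 + k + l + 1 - 1 - (j + 1) = k + l := by omega
  have e3 : j + 1 - 1 = j := by omega
  rw [e1, e2, e3, ofDigits4]
  zify at *
  linear_combination this

theorem Kap_eq_ofDigits4_of_zero {b d x : ℕ} (hd : d < b) (h0 : 0 < d)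
    (h : diffPair b x = (d, 0)) : Kap b x = ofDigits4 b (b - d) (b - 1) (b - 1) (d - 1) := by
  have := (Kap_eq (x := x) (b := b) (by omega)).2
  rw [h] at this
  obtain ⟨l, rfl⟩ := Nat.exists_eq_add_of_lt hd
  obtain ⟨j, rfl⟩ := Nat.exists_eq_add_of_lt h0
  simp only [zero_add] at *
  have e1 : j + 1 + l + 1 - (j + 1) = l + 1 := by omega
  have e2 : j + 1 + l + 1 - 1 = j + 1 + l := by omega
  have e3 : j + 1 - 1 = j := by omega
  rw [e1, e2, e3, ofDigits4]
  zify at *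
  linear_combination this

theorem digitPair_eq_of_le {w x y z : ℕ} (h : x ≤ w) (h' : z ≤ y) (h'' : y ≤ w) :
    digitPair w x y z = (w - min x z, max y (max x z) - min y (max x z)) := by
  rcases le_total y x with h1 | h1
  · rw [digitPair_of_ge h h1 h']
    refine Prod.ext ?_ ?_ <;> dsimp only <;> omega
  rw [digitPair_perm (.cons w (.swap y x _))]
  rcases le_total z x with h2 | h2
  · rw [digitPair_of_ge h'' h1 h2]
    refine Prod.ext ?_ ?_ <;> dsimp only <;> omega
  · rw [digitPair_perm (.cons w (.cons y (.swap z x _))), digitPair_of_ge h'' h' h2]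
    refine Prod.ext ?_ ?_ <;> dsimp only <;> omega

theorem digitPair_eq_of_le_of_le {w x y z : ℕ} (h : x ≤ w) (h' : z ≤ y) :
    digitPair w x y z =
      (max w y - min x z, max (min w y) (max x z) - min (min w y) (max x z)) := by
  rcases le_total y w with h'' | h''
  · rw [digitPair_eq_of_le h h' h'', max_eq_left h'', min_eq_right h'']
  · rw [digitPair_perm (List.perm_append_comm (l₁ := [w, x]) (l₂ := [y, z])),
      digitPair_eq_of_le h' h h'', max_eq_right h'', min_eq_left h'', min_comm z, max_comm z]

theorem diffPair_Kap {b x : ℕ} (hb : 1 < b) :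
    diffPair b (Kap b x) = Kpair b (diffPair b x) := by
  obtain ⟨⟨h1, h2⟩, hK⟩ := Kap_eq (b := b) (x := x) (by omega)
  rcases hde : diffPair b x with ⟨d, e⟩
  rw [hde] at h1 h2 hK
  simp only at h1 h2 hK
  rcases Nat.eq_zero_or_pos e with rfl | he
  · rcases Nat.eq_zero_or_pos d with rfl | hd
    · have : Kap b x = 0 := by simpa using hK
      rw [this]
      simp [diffPair, sortedDigits, Kpair]
    · rw [Kap_eq_ofDigits4_of_zero (by omega) hd hde, diffPair_ofDigits4 (by omega) (by omega)
        (by omega) (by omega), Kpair, if_neg (by dsimp only; omega), if_pos rfl,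
        digitPair_perm (.swap _ _ _), digitPair_eq_of_le_of_le (by omega) (by omega), sort2]
      refine Prod.ext ?_ ?_ <;> dsimp only <;> omega
  · rw [Kap_eq_ofDigits4 h1 (by omega) he hde, diffPair_ofDigits4 (by omega) (by omega)
        (by omega) (by omega), Kpair, if_neg (by dsimp only; omega), if_neg (by dsimp only; omega)]
    clear hK hde
    generalize hp : b - d = p
    generalize hq : b - 1 - e = q
    generalize hr : e - 1 = r
    have e1 : digitPair p q r d = digitPair d p q r :=
      digitPair_perm (List.perm_append_comm (l₁ := [p, q, r]) (l₂ := [d]))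
    have e2 : digitPair d p q r = digitPair p d q r := digitPair_perm (.swap _ _ _)
    have e3 : ∀ x y, digitPair x y q r = digitPair x y r q := fun x y =>
      digitPair_perm (.cons _ (.cons _ (.swap _ _ _)))
    have key : digitPair p q r d =
        (max (max d p) (max q r) - min (min d p) (min q r),
          max (min (max d p) (max q r)) (max (min d p) (min q r)) -
          min (min (max d p) (max q r)) (max (min d p) (min q r))) := by
      rw [e1]
      rcases le_total p d with h | h <;> rcases le_total r q with h' | h' <;>
      [skip; rw [e3]; rw [e2]; rw [e2, e3]] <;>
      rw [digitPair_eq_of_le_of_le h h'] <;>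
        simp only [max_eq_left, min_eq_right, max_eq_right, min_eq_left, h, h']
    rw [key]
    dsimp only
    split_ifs with hb'
    · have hmax : max d p = max q r + 1 := by omega
      have hmin : min d p = min q r + 1 := by omega
      have hx : max q r + min q r + 2 = b := by omega
      have hle : min q r ≤ max q r := min_le_max
      rw [hmax, hmin, sort2]
      have hd : d = max q r + 1 ∨ d = min q r + 1 := by omega
      generalize max q r = hi at *
      generalize min q r = lo at *
      clear key e1 e2 e3
      rcases hd with hd | hd <;> refine Prod.ext ?_ ?_ <;> dsimp only <;> omega
    · have hD : (2 * (d : ℤ) - b).natAbs = max d p - min d p := by omega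
      have hE : (2 * (e : ℤ) - b).natAbs = max q r - min q r := by omega
      have hx : max q r + min q r + 2 = b := by omega
      have hx' : max d p + min d p = b := by omega
      have hle : min q r ≤ max q r := min_le_max
      have hle' : min d p ≤ max d p := min_le_max
      have hne : max d p - min d p ≠ max q r - min q r := by omega
      rw [hD, hE, sort2]
      generalize max q r = hi at *
      generalize min q r = lo at *
      generalize max d p = hi' at *
      generalize min d p = lo' at *
      clear key e1 e2 e3 hD hE
      refine Prod.ext ?_ ?_ <;> dsimp only <;> omega

/-- Two integers prime to `5` exactly one of which is a quadratic residue modulo `5`. -/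
def OppResidues (e e' : ℕ) : Prop := e % 5 ≠ 0 ∧ (e ^ 2 + e' ^ 2) % 5 = 0

instance (e e' : ℕ) : Decidable (OppResidues e e') := inferInstanceAs (Decidable (_ ∧ _))

theorem oppResidues_iff {e e' : ℕ} : OppResidues e e' ↔
    ((e % 5 = 1 ∨ e % 5 = 4) ∧ (e' % 5 = 2 ∨ e' % 5 = 3)) ∨
      ((e % 5 = 2 ∨ e % 5 = 3) ∧ (e' % 5 = 1 ∨ e' % 5 = 4)) := by
  have h : (e ^ 2 + e' ^ 2) % 5 = ((e % 5) ^ 2 + (e' % 5) ^ 2) % 5 := by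
    simp [Nat.add_mod, Nat.pow_mod]
  rw [OppResidues, h]
  have h1 := Nat.mod_lt e (show 0 < 5 by norm_num)
  have h2 := Nat.mod_lt e' (show 0 < 5 by norm_num)
  generalize e % 5 = i at *
  generalize e' % 5 = j at *
  interval_cases i <;> interval_cases j <;> simp

theorem OppResidues.symm {e e' : ℕ} (h : OppResidues e e') : OppResidues e' e := by
  rw [oppResidues_iff] at *; tauto

/-- The pairs `(M * e, M * e')` with `e` and `e'` opposite. -/
def Good (M : ℕ) (p : ℕ × ℕ) : Prop := ∃ e e', p = (M * e, M * e') ∧ OppResidues e e'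

theorem good_sort2 {M : ℕ} {p : ℕ × ℕ} : Good M (sort2 p) ↔ Good M p := by
  rcases p with ⟨x, y⟩
  rcases le_total x y with h | h
  · simp only [sort2, h, max_eq_right, min_eq_left]
    constructor <;> rintro ⟨e, e', h, h'⟩ <;> rw [Prod.mk.injEq] at h <;>
      exact ⟨e', e, by rw [h.1, h.2], h'.symm⟩
  · simp only [sort2, h, max_eq_left, min_eq_right]

theorem Good.Kpair_eq {M B : ℕ} {p : ℕ × ℕ} (h : Good M p) (hM : 0 < M) :
    Kpair (5 * M * B) p = sort2 ((2 * (p.1 : ℤ) - (5 * M * B : ℕ)).natAbs,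
      (2 * (p.2 : ℤ) - (5 * M * B : ℕ)).natAbs) := by
  obtain ⟨e, e', rfl, h⟩ := h
  rw [oppResidues_iff] at h
  have he' : M * e' ≠ 0 := mul_ne_zero hM.ne' (by omega)
  rw [Kpair, if_neg (by simp_all), if_neg he', if_neg]
  rintro (h1 | h1)
  · have := Nat.eq_of_mul_eq_mul_left hM h1
    omega
  · have : e + e' = 5 * B := Nat.eq_of_mul_eq_mul_left hM (by dsimp only at h1; linarith)
    omega

theorem oppResidues_natAbs {e e' B : ℕ} :
    OppResidues ((e : ℤ) - 5 * B).natAbs ((e' : ℤ) - 5 * B).natAbs ↔ OppResidues e e' := by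
  simp only [oppResidues_iff]
  omega

theorem oppResidues_natAbs_two {e e' B : ℕ} :
    OppResidues (2 * (e : ℤ) - 5 * B).natAbs (2 * (e' : ℤ) - 5 * B).natAbs ↔ OppResidues e e' := by
  simp only [oppResidues_iff]
  omega

theorem Good.two_mul {M B : ℕ} {p : ℕ × ℕ} (h : Good M p) (hM : 0 < M) :
    Good (2 * M) (Kpair (5 * (2 * M) * B) p) := by
  rw [show 5 * (2 * M) * B = 5 * M * (2 * B) by ring, h.Kpair_eq hM, good_sort2]
  obtain ⟨e, e', rfl, h⟩ := h
  refine ⟨_, _, ?_, oppResidues_natAbs (B := B) |>.2 h⟩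
  have : ∀ x : ℕ, (2 * ((M * x : ℕ) : ℤ) - (5 * M * (2 * B) : ℕ)).natAbs =
      2 * M * ((x : ℤ) - 5 * B).natAbs := fun x => by
    rw [← Int.natAbs_natCast (2 * M), ← Int.natAbs_mul]
    congr 1
    push_cast
    ring
  rw [this, this]

theorem good_Kpair_iff {m B : ℕ} {p : ℕ × ℕ} (hm : Odd m) (hm1 : 1 < m) (hB : 0 < B)
    (hp : IsDiffPair (5 * m * B) p) : Good m (Kpair (5 * m * B) p) ↔ Good m p := by
  have hdvd : ∀ {q}, Good m q → m ∣ q.1 ∧ m ∣ q.2 := by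
    rintro q ⟨e, e', rfl, -⟩
    exact ⟨dvd_mul_right _ _, dvd_mul_right _ _⟩
  have hscale : ∀ x : ℕ, (2 * ((m * x : ℕ) : ℤ) - (5 * m * B : ℕ)).natAbs =
      m * (2 * (x : ℤ) - 5 * B).natAbs := fun x => by
    rw [← Int.natAbs_natCast m, ← Int.natAbs_mul, Int.natAbs_natCast]
    congr 1
    push_cast
    ring
  constructor
  · intro h
    rcases p with ⟨d, d'⟩
    have hb : m ∣ 5 * m * B := ⟨5 * B, by ring⟩
    have hb' : (m : ℤ) ∣ ((5 * m * B : ℕ) : ℤ) := Int.natCast_dvd_natCast.2 hb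
    have hbpos : 0 < 5 * m * B := by positivity
    have hd : d ≤ 5 * m * B - 1 := hp.2
    rw [Kpair] at h
    split_ifs at h with h1 h2 h3
    · obtain ⟨e, e', h, h'⟩ := h
      rw [oppResidues_iff] at h'
      have : e ≠ 0 := by omega
      rw [Prod.mk.injEq] at h
      simp_all
    · exfalso
      obtain ⟨g1, g2⟩ := hdvd (good_sort2.1 h)
      dsimp only at g1 g2 h1 h2
      have g3 := (Nat.dvd_sub hb (dvd_add g1 g2))
      rw [show 5 * m * B - (d - 1 + (5 * m * B - d)) = 1 by omega] at g3
      have := Nat.le_of_dvd one_pos g3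
      omega
    · exfalso
      obtain ⟨g1, g2⟩ := hdvd (good_sort2.1 h)
      dsimp only at g1 g2
      rw [← Int.natCast_dvd] at g1 g2
      have g3 := dvd_sub g1 g2
      rw [show (2 * (d : ℤ) - ((5 * m * B : ℕ) - 1) - (2 * d - ((5 * m * B : ℕ) + 1))) = (2 : ℕ) by
        push_cast; ring, Int.natCast_dvd_natCast] at g3
      have := Nat.le_of_dvd two_pos g3
      have := hm.not_two_dvd_nat
      interval_cases m
      omega
    · rw [good_sort2] at h
      obtain ⟨g1, g2⟩ := hdvd h
      dsimp only at g1 g2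
      rw [← Int.natCast_dvd] at g1 g2
      have hco : Nat.Coprime m 2 := hm.coprime_two_right
      have key : ∀ x : ℕ, (m : ℤ) ∣ 2 * x - (5 * m * B : ℕ) → m ∣ x := fun x hx => by
        have := (dvd_sub_left hb').1 hx
        exact hco.dvd_of_dvd_mul_left (by exact_mod_cast this)
      obtain ⟨e, rfl⟩ := key _ g1
      obtain ⟨e', rfl⟩ := key _ g2
      refine ⟨e, e', rfl, ?_⟩
      obtain ⟨f, f', h, h'⟩ := h
      dsimp only at h
      rw [hscale, hscale, Prod.mk.injEq] at h
      have hm0 : 0 < m := by omega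
      rw [← oppResidues_natAbs_two (B := B), Nat.eq_of_mul_eq_mul_left hm0 h.1,
        Nat.eq_of_mul_eq_mul_left hm0 h.2]
      exact h'
  · intro h
    rw [h.Kpair_eq (by omega), good_sort2]
    obtain ⟨e, e', rfl, h⟩ := h
    exact ⟨_, _, by rw [hscale, hscale], oppResidues_natAbs_two.2 h⟩

theorem Kpair_fixed {k : ℕ} (hk : 0 < k) : Kpair (5 * k) (3 * k, k) = (3 * k, k) := by
  rw [Kpair]
  dsimp only
  rw [if_neg (by omega), if_neg (by omega), if_neg (by omega), sort2]
  refine Prod.ext ?_ ?_ <;> dsimp only <;> omega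

theorem eq_of_Kpair_fixed {k : ℕ} {p : ℕ × ℕ} (hk : 1 < k) (hp : IsDiffPair (5 * k) p)
    (h : Kpair (5 * k) p = p) (h0 : p ≠ (0, 0)) : p = (3 * k, k) := by
  obtain ⟨d, e⟩ := p
  have h1 : e ≤ d := hp.1
  have h2 : d ≤ 5 * k - 1 := hp.2
  rw [Kpair] at h
  dsimp only at h
  rw [Prod.mk.injEq]
  split_ifs at h with h3 h4 h5
  · exact absurd (by rw [h3.1, h3.2]) h0
  all_goals
    rw [sort2, Prod.mk.injEq] at h
    dsimp only at h
    omega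

theorem Kpair_eq_of_good {k : ℕ} {p : ℕ × ℕ} (hk : 0 < k) (hp : IsDiffPair (5 * k) p)
    (h : Good k p) : Kpair (5 * k) p = (3 * k, k) := by
  have h' := h.Kpair_eq (B := 1) hk
  rw [mul_one] at h'
  rw [h', sort2]
  obtain ⟨e, e', rfl, h⟩ := h
  have h1 : k * e' ≤ k * e := hp.1
  have h2 : k * e ≤ 5 * k - 1 := hp.2
  have h3 : e' ≤ e := Nat.le_of_mul_le_mul_left h1 hk
  have h4 : e < 5 := by by_contra! hc; have := Nat.mul_le_mul_left k hc; omega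
  rw [oppResidues_iff] at h
  interval_cases e <;> interval_cases e' <;> simp at h <;>
    refine Prod.ext ?_ ?_ <;> dsimp only <;> omega

theorem isDiffPair_diffPair {b x : ℕ} (hb : 0 < b) : IsDiffPair b (diffPair b x) :=
  (Kap_eq hb).1

theorem Kap_eq_of_diffPair {b x y : ℕ} (hb : 0 < b) (h : diffPair b x = diffPair b y) :
    Kap b x = Kap b y := by
  have h1 := (Kap_eq (x := x) hb).2
  have h2 := (Kap_eq (x := y) hb).2
  rw [h] at h1
  omega

theorem diffPair_iterate_good {m n x j : ℕ} (hm : 1 < m) (hj : j ≤ n)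
    (h : Good m (diffPair (5 * m * 2 ^ n) x)) :
    Good (m * 2 ^ j) (diffPair (5 * m * 2 ^ n) ((Kap (5 * m * 2 ^ n))^[j] x)) := by
  have hb : 1 < 5 * m * 2 ^ n := by nlinarith [Nat.one_le_two_pow (n := n)]
  induction j with
  | zero => simpa using h
  | succ j ih =>
    rw [Function.iterate_succ_apply', diffPair_Kap hb]
    have := (ih (by omega)).two_mul (B := 2 ^ (n - (j + 1))) (by positivity)
    have e : 5 * (2 * (m * 2 ^ j)) * 2 ^ (n - (j + 1)) = 5 * m * 2 ^ n := by
      obtain ⟨k, rfl⟩ := Nat.exists_eq_add_of_le hj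
      rw [Nat.add_sub_cancel_left]
      ring
    rw [e] at this
    convert this using 1
    ring

theorem mem_KapSet_iff {m n x : ℕ} (hm : Odd m) (hm1 : 1 < m) :
    x ∈ KapSet (5 * m * 2 ^ n) ↔
      x < (5 * m * 2 ^ n) ^ 4 ∧ Good m (diffPair (5 * m * 2 ^ n) x) := by
  have hb : 1 < 5 * m * 2 ^ n := by nlinarith [Nat.one_le_two_pow (n := n)]
  have hb0 : 0 < 5 * m * 2 ^ n := by omega
  have hk : 1 < m * 2 ^ n := by nlinarith [Nat.one_le_two_pow (n := n)]
  have hbk : 5 * m * 2 ^ n = 5 * (m * 2 ^ n) := by ring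
  have hiter : ∀ t, Good m (diffPair (5 * m * 2 ^ n) ((Kap (5 * m * 2 ^ n))^[t] x)) ↔
      Good m (diffPair (5 * m * 2 ^ n) x) := fun t => by
    induction t with
    | zero => rfl
    | succ t ih =>
      rw [Function.iterate_succ_apply', diffPair_Kap hb, good_Kpair_iff hm hm1 (by positivity)
        (isDiffPair_diffPair hb0), ih]
  refine and_congr_right fun _ => ⟨?_, fun h => ?_⟩
  · rintro ⟨t, ht, h0⟩
    rw [← hiter t]
    have hfix := ht (t + 1) (by omega)
    rw [Function.iterate_succ_apply'] at hfix
    generalize (Kap (5 * m * 2 ^ n))^[t] x = w at *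
    have hK := (Kap_eq (x := w) hb0).2
    have h1 : diffPair (5 * m * 2 ^ n) w = (3 * (m * 2 ^ n), m * 2 ^ n) := by
      refine eq_of_Kpair_fixed hk (hbk ▸ isDiffPair_diffPair hb0) ?_ fun h => h0 ?_
      · rw [← hbk, ← diffPair_Kap hb, hfix]
      · rw [h, hfix] at hK
        simpa using hK
    rw [h1]
    refine ⟨3 * 2 ^ n, 2 ^ n, by ring_nf, ?_⟩
    have : ¬ 5 ∣ 2 ^ n := fun h => by
      have := Nat.prime_five.dvd_of_dvd_pow h
      omega
    have : 2 ^ n % 5 = 1 ∨ 2 ^ n % 5 = 2 ∨ 2 ^ n % 5 = 3 ∨ 2 ^ n % 5 = 4 := by omega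
    rw [oppResidues_iff]
    rcases this with h | h | h | h <;> omega
  · have h1 := diffPair_iterate_good hm1 le_rfl h
    have hs : ∀ s, diffPair (5 * m * 2 ^ n) ((Kap (5 * m * 2 ^ n))^[n + 1 + s] x) =
        (3 * (m * 2 ^ n), m * 2 ^ n) := fun s => by
      induction s with
      | zero =>
        rw [add_zero, Function.iterate_succ_apply', diffPair_Kap hb]
        have h2 := isDiffPair_diffPair (x := (Kap (5 * m * 2 ^ n))^[n] x) hb0
        generalize diffPair (5 * m * 2 ^ n) ((Kap (5 * m * 2 ^ n))^[n] x) = q at *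
        rw [hbk] at *
        exact Kpair_eq_of_good (by omega) h2 h1
      | succ s ih =>
        rw [← add_assoc, Function.iterate_succ_apply', diffPair_Kap hb, ih, hbk,
          Kpair_fixed (by omega)]
    refine ⟨n + 1 + 1, fun s hs' => ?_, fun h0 => ?_⟩
    · obtain ⟨k, rfl⟩ := Nat.exists_eq_add_of_le hs'
      rw [show n + 1 + 1 + k = (n + 1 + k) + 1 by ring, Function.iterate_succ_apply',
        Function.iterate_succ_apply']
      exact Kap_eq_of_diffPair hb0 ((hs k).trans (hs 0).symm)
    · have := hs 1
      rw [h0] at this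
      simp [diffPair, sortedDigits] at this
      omega

/-- The quadruples of digits whose difference pair satisfies `P`. -/
noncomputable def digitQuads (b : ℕ) (P : ℕ × ℕ → Prop) : Finset (ℕ × ℕ × ℕ × ℕ) :=
  open Classical in
  (range b ×ˢ range b ×ˢ range b ×ˢ range b).filter fun t => P (digitPair t.1 t.2.1 t.2.2.1 t.2.2.2)

theorem mem_digitQuads {b : ℕ} {P : ℕ × ℕ → Prop} {w x y z : ℕ} :
    (w, x, y, z) ∈ digitQuads b P ↔
      (w < b ∧ x < b ∧ y < b ∧ z < b) ∧ P (digitPair w x y z) := by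
  simp [digitQuads]

theorem card_eq_sum_of_existsUnique {α ι : Type*} [Fintype ι] (s : Finset α) (p : ι → α → Prop)
    [∀ i, DecidablePred (p i)] (h : ∀ t ∈ s, ∃! i, p i t) : #s = ∑ i, #{t ∈ s | p i t} := by
  simp only [card_filter]
  rw [sum_comm, card_eq_sum_ones]
  refine sum_congr rfl fun t ht => ?_
  rw [← card_filter, eq_comm, card_eq_one]
  obtain ⟨i, hi, hu⟩ := h t ht
  exact ⟨i, by ext j; simp only [mem_filter, mem_univ, true_and, mem_singleton]
               exact ⟨hu j, fun h => h ▸ hi⟩⟩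

/-- Involutions of the coordinates bringing each pair of positions to the front. -/
def toFront : Fin 6 → ℕ × ℕ × ℕ × ℕ → ℕ × ℕ × ℕ × ℕ
  | 0, (w, x, y, z) => (w, x, y, z)
  | 1, (w, x, y, z) => (w, y, x, z)
  | 2, (w, x, y, z) => (w, z, y, x)
  | 3, (w, x, y, z) => (y, x, w, z)
  | 4, (w, x, y, z) => (z, x, y, w)
  | 5, (w, x, y, z) => (y, z, w, x)

/-- The first two coordinates exceed the last two. -/
def FrontAbove : ℕ × ℕ × ℕ × ℕ → Prop
  | (w, x, y, z) => y < w ∧ z < w ∧ y < x ∧ z < x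

/-- The coordinates decrease, with equality allowed only at the end. -/
def DecreasingLeft : ℕ × ℕ × ℕ × ℕ → Prop
  | (w, x, y, z) => x < w ∧ y < x ∧ z ≤ y

/-- The coordinates decrease, with equality allowed only at the start. -/
def DecreasingRight : ℕ × ℕ × ℕ × ℕ → Prop
  | (w, x, y, z) => x ≤ w ∧ y < x ∧ z < y

/-- Reversing both the first two and the last two coordinates. -/
def swapBoth : ℕ × ℕ × ℕ × ℕ → ℕ × ℕ × ℕ × ℕ
  | (w, x, y, z) => (x, w, z, y)

/-- Reversing the first two coordinates. -/
def swapFirst : ℕ × ℕ × ℕ × ℕ → ℕ × ℕ × ℕ × ℕ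
  | (w, x, y, z) => (x, w, y, z)

/-- Reversing the last two coordinates. -/
def swapLast : ℕ × ℕ × ℕ × ℕ → ℕ × ℕ × ℕ × ℕ
  | (w, x, y, z) => (w, x, z, y)

theorem perm_swap_zero_two (w x y z : ℕ) : [w, x, y, z].Perm [y, x, w, z] :=
  ((List.Perm.swap _ _ _).trans (.cons _ (.swap _ _ _))).trans (.swap _ _ _)

theorem perm_swap_one_three (w x y z : ℕ) : [w, x, y, z].Perm [w, z, y, x] :=
  .cons w (((List.Perm.swap _ _ _).trans (.cons _ (.swap _ _ _))).trans (.swap _ _ _))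

theorem perm_swap_pairs (w x y z : ℕ) : [w, x, y, z].Perm [y, z, w, x] :=
  List.perm_append_comm (l₁ := [w, x]) (l₂ := [y, z])

theorem perm_swap_zero_three (w x y z : ℕ) : [w, x, y, z].Perm [z, x, y, w] :=
  ((perm_swap_one_three w x y z).trans (.swap _ _ _)).trans (perm_swap_one_three z w y x)

open Classical in
theorem card_filter_digitQuads_comp {b : ℕ} {P : ℕ × ℕ → Prop}
    (σ : ℕ × ℕ × ℕ × ℕ → ℕ × ℕ × ℕ × ℕ) (hσ : ∀ t ∈ digitQuads b P, σ t ∈ digitQuads b P)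
    (hinv : Function.Involutive σ) (R : ℕ × ℕ × ℕ × ℕ → Prop) :
    #{t ∈ digitQuads b P | R (σ t)} = #{t ∈ digitQuads b P | R t} := by
  refine card_nbij' σ σ ?_ ?_ (fun t _ => hinv t) (fun t _ => hinv t)
  · intro t ht
    simp only [coe_filter, Set.mem_ofPred_eq] at ht ⊢
    exact ⟨hσ t ht.1, ht.2⟩
  · intro t ht
    simp only [coe_filter, Set.mem_ofPred_eq] at ht ⊢
    exact ⟨hσ t ht.1, by rw [hinv]; exact ht.2⟩

theorem toFront_mem {b : ℕ} {P : ℕ × ℕ → Prop} (i : Fin 6) :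
    ∀ t ∈ digitQuads b P, toFront i t ∈ digitQuads b P := by
  rintro ⟨w, x, y, z⟩ h
  fin_cases i <;> simp only [toFront, mem_digitQuads] at h ⊢
  · exact h
  · exact ⟨by tauto, digitPair_perm (.cons w (.swap y x _)) ▸ h.2⟩
  · exact ⟨by tauto, digitPair_perm (perm_swap_one_three w x y z) ▸ h.2⟩
  · exact ⟨by tauto, digitPair_perm (perm_swap_zero_two w x y z) ▸ h.2⟩
  · exact ⟨by tauto, digitPair_perm (perm_swap_zero_three w x y z) ▸ h.2⟩
  · exact ⟨by tauto, digitPair_perm (perm_swap_pairs w x y z) ▸ h.2⟩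

theorem toFront_involutive (i : Fin 6) : Function.Involutive (toFront i) := by
  rintro ⟨w, x, y, z⟩
  fin_cases i <;> rfl

theorem swapBoth_mem {b : ℕ} {P : ℕ × ℕ → Prop} :
    ∀ t ∈ digitQuads b P, swapBoth t ∈ digitQuads b P := by
  rintro ⟨w, x, y, z⟩ h
  simp only [swapBoth, mem_digitQuads] at h ⊢
  refine ⟨by tauto, ?_⟩
  have h1 : [w, x, y, z].Perm [x, w, z, y] :=
    (List.Perm.swap _ _ _).trans (.cons _ (.cons _ (.swap _ _ _)))
  exact digitPair_perm h1 ▸ h.2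

theorem swapFirst_mem {b : ℕ} {P : ℕ × ℕ → Prop} :
    ∀ t ∈ digitQuads b P, swapFirst t ∈ digitQuads b P := by
  rintro ⟨w, x, y, z⟩ h
  simp only [swapFirst, mem_digitQuads] at h ⊢
  exact ⟨by tauto, digitPair_perm (.swap x w _) ▸ h.2⟩

theorem swapLast_mem {b : ℕ} {P : ℕ × ℕ → Prop} :
    ∀ t ∈ digitQuads b P, swapLast t ∈ digitQuads b P := by
  rintro ⟨w, x, y, z⟩ h
  simp only [swapLast, mem_digitQuads] at h ⊢
  exact ⟨by tauto, digitPair_perm (.cons w (.cons x (.swap z y _))) ▸ h.2⟩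

theorem exists_frontAbove_toFront {w x y z : ℕ} (h : (digitPair w x y z).2 ≠ 0) :
    ∃ i, FrontAbove (toFront i (w, x, y, z)) := by
  wlog hwx : x ≤ w generalizing w x
  · obtain ⟨i, hi⟩ := this (w := x) (x := w) (digitPair_perm (.swap x w _) ▸ h) (by omega)
    refine ⟨![0, 3, 4, 1, 2, 5] i, ?_⟩
    fin_cases i <;> simp [FrontAbove, toFront] at hi ⊢ <;> omega
  wlog hyz : z ≤ y generalizing y z
  · obtain ⟨i, hi⟩ := this (y := z) (z := y)
      (digitPair_perm (.cons w (.cons x (.swap z y _))) ▸ h) (by omega)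
    refine ⟨![0, 2, 1, 4, 3, 5] i, ?_⟩
    fin_cases i <;> simp [FrontAbove, toFront] at hi ⊢ <;> omega
  rw [digitPair_eq_of_le_of_le hwx hyz] at h
  have : (y < x) ∨ (w < z) ∨ (x < y ∧ z < w) := by dsimp only at h; omega
  rcases this with h | h | h
  · exact ⟨0, by simp only [FrontAbove, toFront]; omega⟩
  · exact ⟨5, by simp only [FrontAbove, toFront]; omega⟩
  · exact ⟨1, by simp only [FrontAbove, toFront]; omega⟩

theorem eq_of_frontAbove_toFront {t : ℕ × ℕ × ℕ × ℕ} {i j : Fin 6}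
    (hi : FrontAbove (toFront i t)) (hj : FrontAbove (toFront j t)) : i = j := by
  obtain ⟨w, x, y, z⟩ := t
  fin_cases i <;> fin_cases j <;> first
    | rfl
    | (exfalso; simp only [toFront, FrontAbove] at hi hj; omega)

open Classical in
theorem card_digitQuads_eq_six_mul {b : ℕ} {P : ℕ × ℕ → Prop} (hP : ∀ p, P p → p.2 ≠ 0) :
    #(digitQuads b P) = 6 * #{t ∈ digitQuads b P | FrontAbove t} := by
  rw [card_eq_sum_of_existsUnique _ fun i t => FrontAbove (toFront i t)]
  · simp only [card_filter_digitQuads_comp _ (toFront_mem _) (toFront_involutive _)]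
    simp
  · rintro ⟨w, x, y, z⟩ ht
    obtain ⟨i, hi⟩ := exists_frontAbove_toFront (hP _ (mem_digitQuads.1 ht).2)
    exact ⟨i, hi, fun j hj => eq_of_frontAbove_toFront hj hi⟩

open Classical in
theorem card_frontAbove {b : ℕ} {P : ℕ × ℕ → Prop} (hP : ∀ p, P p → p.2 ≠ p.1) :
    #{t ∈ digitQuads b P | FrontAbove t} =
      2 * (#{t ∈ digitQuads b P | DecreasingLeft t} +
        #{t ∈ digitQuads b P | DecreasingRight t}) := by
  let p : Fin 4 → ℕ × ℕ × ℕ × ℕ → Prop :=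
    ![DecreasingLeft, fun t => DecreasingLeft (swapBoth t), fun t => DecreasingRight (swapFirst t),
      fun t => DecreasingRight (swapLast t)]
  rw [card_eq_sum_of_existsUnique _ p, Fin.sum_univ_four]
  · have h : ∀ i, {t ∈ {t ∈ digitQuads b P | FrontAbove t} | p i t} =
        {t ∈ digitQuads b P | p i t} := fun i => by
      rw [filter_filter]
      refine filter_congr fun ⟨w, x, y, z⟩ _ => and_iff_right_of_imp ?_
      fin_cases i <;>
        simp [p, DecreasingLeft, DecreasingRight, swapBoth, swapFirst, swapLast, FrontAbove] <;>
        omega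
    simp only [h]
    have h1 := card_filter_digitQuads_comp swapBoth (swapBoth_mem (b := b) (P := P))
      (fun _ => rfl) DecreasingLeft
    have h2 := card_filter_digitQuads_comp swapFirst (swapFirst_mem (b := b) (P := P))
      (fun _ => rfl) DecreasingRight
    have h3 := card_filter_digitQuads_comp swapLast (swapLast_mem (b := b) (P := P))
      (fun _ => rfl) DecreasingRight
    have e0 : #{t ∈ digitQuads b P | p 0 t} = #{t ∈ digitQuads b P | DecreasingLeft t} := rfl
    have e1 : #{t ∈ digitQuads b P | p 1 t} = _ := h1
    have e2 : #{t ∈ digitQuads b P | p 2 t} = _ := h2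
    have e3 : #{t ∈ digitQuads b P | p 3 t} = _ := h3
    rw [e0, e1, e2, e3]
    ring
  · rintro ⟨w, x, y, z⟩ ht
    obtain ⟨ht, hf⟩ := mem_filter.1 ht
    have ht := hP _ (mem_digitQuads.1 ht).2
    simp only [FrontAbove] at hf
    have hne : ¬(w = x ∧ y = z) := by
      rintro ⟨rfl, rfl⟩
      exact ht (by rw [digitPair_of_ge le_rfl hf.1.le le_rfl])
    have hex : ∃ i, p i (w, x, y, z) := by
      have : (x < w ∧ y < x ∧ z ≤ y) ∨ (w < x ∧ z < w ∧ y ≤ z) ∨ (w ≤ x ∧ y < w ∧ z < y) ∨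
          (x ≤ w ∧ z < x ∧ y < z) := by omega
      rcases this with h | h | h | h
      exacts [⟨0, h⟩, ⟨1, h⟩, ⟨2, h⟩, ⟨3, h⟩]
    obtain ⟨i, hi⟩ := hex
    refine ⟨i, hi, fun j hj => ?_⟩
    dsimp only at hj
    fin_cases i <;> fin_cases j <;> first
      | rfl
      | (exfalso
         simp [p, DecreasingLeft, DecreasingRight, swapBoth, swapFirst, swapLast] at hi hj
         omega)

/-- The multipliers of the difference pairs being counted. -/
def oppPairs (B : ℕ) : Finset (ℕ × ℕ) :=
  {p ∈ range B ×ˢ range B | p.2 < p.1 ∧ OppResidues p.1 p.2}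

/-- Parameters for the decreasing quadruples: a difference pair, the least digit and an offset. -/
def quadParams (M B : ℕ) : Finset (Σ _ : ℕ × ℕ, ℕ × ℕ) :=
  (oppPairs B).sigma fun p => range (M * (B - p.1)) ×ˢ range (M * (p.1 - p.2))

theorem card_quadParams (M B : ℕ) :
    #(quadParams M B) = M ^ 2 * ∑ p ∈ oppPairs B, (B - p.1) * (p.1 - p.2) := by
  rw [quadParams, card_sigma, mul_sum]
  refine sum_congr rfl fun p _ => ?_
  rw [card_product, card_range, card_range]
  ring

theorem mem_quadParams {M B e e' a i : ℕ} : ⟨(e, e'), (a, i)⟩ ∈ quadParams M B ↔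
    (e < B ∧ e' < e ∧ OppResidues e e') ∧ a + M * e < M * B ∧ i + M * e' < M * e := by
  simp only [quadParams, oppPairs, mem_sigma, mem_filter, mem_product, mem_range, Nat.mul_sub]
  constructor
  · rintro ⟨⟨⟨h1, h2⟩, h3, h4⟩, h5, h6⟩
    exact ⟨⟨h1, h3, h4⟩, by omega, by omega⟩
  · rintro ⟨⟨h1, h3, h4⟩, h5, h6⟩
    exact ⟨⟨⟨h1, by omega⟩, h3, h4⟩, by omega, by omega⟩

open Classical in
theorem card_decreasingLeft {M B : ℕ} (hM : 0 < M) :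
    #{t ∈ digitQuads (M * B) (Good M) | DecreasingLeft t} = #(quadParams M B) := by
  symm
  refine card_bij (fun p _ =>
    (p.2.1 + M * p.1.1, p.2.1 + p.2.2 + M * p.1.2, p.2.1 + p.2.2, p.2.1)) ?_ ?_ ?_
  · rintro ⟨⟨e, e'⟩, a, i⟩ h
    obtain ⟨⟨h1, h2, h3⟩, h4, h5⟩ := mem_quadParams.1 h
    have : 0 < M * e' := Nat.mul_pos hM (by rw [oppResidues_iff] at h3; omega)
    rw [mem_filter, mem_digitQuads]
    simp only [DecreasingLeft]
    refine ⟨⟨by omega, e, e', ?_, h3⟩, by omega⟩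
    rw [digitPair_of_ge (by omega) (by omega) (by omega)]
    refine Prod.ext ?_ ?_ <;> dsimp only <;> omega
  · rintro ⟨⟨e, e'⟩, a, i⟩ h ⟨⟨f, f'⟩, a', i'⟩ h' heq
    simp only [Prod.mk.injEq] at heq
    obtain ⟨g1, g2, g3, rfl⟩ := heq
    obtain rfl : i = i' := by omega
    obtain rfl : e = f := Nat.eq_of_mul_eq_mul_left hM (by omega)
    obtain rfl : e' = f' := Nat.eq_of_mul_eq_mul_left hM (by omega)
    rfl
  · rintro ⟨w, x, y, z⟩ h
    rw [mem_filter, mem_digitQuads] at h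
    simp only [DecreasingLeft] at h
    obtain ⟨⟨h1, e, e', h2, h3⟩, h4, h5, h6⟩ := h
    rw [digitPair_of_ge (by omega) (by omega) (by omega), Prod.mk.injEq] at h2
    have he : e < B := Nat.lt_of_mul_lt_mul_left (a := M) (by omega)
    have he' : e' < e := Nat.lt_of_mul_lt_mul_left (a := M) (by omega)
    refine ⟨⟨(e, e'), (z, y - z)⟩, mem_quadParams.2 ⟨⟨he, he', h3⟩, by omega, by omega⟩, ?_⟩
    refine Prod.ext ?_ (Prod.ext ?_ (Prod.ext ?_ ?_)) <;> dsimp only <;> omega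

open Classical in
theorem card_decreasingRight {M B : ℕ} (hM : 0 < M) :
    #{t ∈ digitQuads (M * B) (Good M) | DecreasingRight t} = #(quadParams M B) := by
  symm
  refine card_bij (fun p _ => (p.2.1 + M * p.1.1, p.2.1 + M * p.1.1 - p.2.2,
    p.2.1 + M * p.1.1 - p.2.2 - M * p.1.2, p.2.1)) ?_ ?_ ?_
  · rintro ⟨⟨e, e'⟩, a, i⟩ h
    obtain ⟨⟨h1, h2, h3⟩, h4, h5⟩ := mem_quadParams.1 h
    have : 0 < M * e' := Nat.mul_pos hM (by rw [oppResidues_iff] at h3; omega)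
    rw [mem_filter, mem_digitQuads]
    simp only [DecreasingRight]
    refine ⟨⟨by omega, e, e', ?_, h3⟩, by omega⟩
    rw [digitPair_of_ge (by omega) (by omega) (by omega)]
    refine Prod.ext ?_ ?_ <;> dsimp only <;> omega
  · rintro ⟨⟨e, e'⟩, a, i⟩ h ⟨⟨f, f'⟩, a', i'⟩ h' heq
    obtain ⟨-, h4, h5⟩ := mem_quadParams.1 h
    obtain ⟨-, h4', h5'⟩ := mem_quadParams.1 h'
    simp only [Prod.mk.injEq] at heq
    obtain ⟨g1, g2, g3, rfl⟩ := heq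
    obtain rfl : e = f := Nat.eq_of_mul_eq_mul_left hM (by omega)
    obtain rfl : i = i' := by omega
    obtain rfl : e' = f' := Nat.eq_of_mul_eq_mul_left hM (by omega)
    rfl
  · rintro ⟨w, x, y, z⟩ h
    rw [mem_filter, mem_digitQuads] at h
    simp only [DecreasingRight] at h
    obtain ⟨⟨h1, e, e', h2, h3⟩, h4, h5, h6⟩ := h
    rw [digitPair_of_ge (by omega) (by omega) (by omega), Prod.mk.injEq] at h2
    have he : e < B := Nat.lt_of_mul_lt_mul_left (a := M) (by omega)
    have he' : e' < e := Nat.lt_of_mul_lt_mul_left (a := M) (by omega)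
    refine ⟨⟨(e, e'), (z, w - x)⟩, mem_quadParams.2 ⟨⟨he, he', h3⟩, by omega, by omega⟩, ?_⟩
    refine Prod.ext ?_ (Prod.ext ?_ (Prod.ext ?_ ?_)) <;> dsimp only <;> omega

theorem sum_range_oppResidues (r : ℕ) (hr : r % 5 ≠ 0) (q : ℕ) (c : ℤ) :
    ∑ e ∈ range (5 * q), (if OppResidues r e then c - e else 0) = 2 * c * q - 5 * q ^ 2 := by
  induction q with
  | zero => simp
  | succ q ih =>
    rw [show 5 * (q + 1) = 5 * q + 1 + 1 + 1 + 1 + 1 by ring]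
    rw [sum_range_succ, sum_range_succ, sum_range_succ, sum_range_succ, sum_range_succ, ih]
    simp only [oppResidues_iff]
    have : r % 5 = 1 ∨ r % 5 = 2 ∨ r % 5 = 3 ∨ r % 5 = 4 := by omega
    rcases this with h | h | h | h <;> simp [h, Nat.add_mod, Nat.mul_mod_right] <;> ring

theorem sum_range_mod_eq_zero {r : ℕ} (hr : r % 5 = 0) (k : ℕ) (c : ℤ) :
    ∑ e ∈ range k, (if OppResidues r e then c - e else 0) = 0 :=
  sum_eq_zero fun _ _ => if_neg fun h => h.1 hr

theorem three_mul_sum_range (N : ℕ) (c : ℤ) :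
    3 * ∑ e ∈ range (5 * N), (c - e) * ∑ e' ∈ range e,
      (if OppResidues e e' then (e : ℤ) - e' else 0) =
      c * (20 * N ^ 3 - 2 * N) - 3 * (25 * N ^ 4 - 5 * N ^ 2) := by
  induction N with
  | zero => simp
  | succ q ih =>
    rw [show 5 * (q + 1) = 5 * q + 1 + 1 + 1 + 1 + 1 by ring]
    have h0 := sum_range_mod_eq_zero (r := 5 * q) (by omega) (5 * q) (5 * q : ℕ)
    have h1 := sum_range_oppResidues (5 * q + 1) (by omega) q (5 * q + 1 : ℕ)
    have h2 := sum_range_oppResidues (5 * q + 1 + 1) (by omega) q (5 * q + 1 + 1 : ℕ)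
    have h3 := sum_range_oppResidues (5 * q + 1 + 1 + 1) (by omega) q (5 * q + 1 + 1 + 1 : ℕ)
    have h4 := sum_range_oppResidues (5 * q + 1 + 1 + 1 + 1) (by omega) q
      (5 * q + 1 + 1 + 1 + 1 : ℕ)
    simp only [sum_range_succ, mul_add, ih, h0, h1, h2, h3, h4]
    simp [oppResidues_iff, Nat.add_mod, Nat.mul_mod_right]
    ring

theorem three_mul_sum_oppPairs (N : ℕ) :
    3 * ∑ p ∈ oppPairs (5 * N), (5 * N - p.1) * (p.1 - p.2) = 5 * N ^ 2 * (1 + 5 * N ^ 2) := by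
  have h := three_mul_sum_range N (5 * N : ℕ)
  have : ((∑ p ∈ oppPairs (5 * N), (5 * N - p.1) * (p.1 - p.2) : ℕ) : ℤ) =
      ∑ e ∈ range (5 * N), ((5 * N : ℕ) - e : ℤ) * ∑ e' ∈ range e,
      (if OppResidues e e' then (e : ℤ) - e' else 0) := by
    rw [oppPairs, sum_filter, sum_product, Nat.cast_sum]
    refine sum_congr rfl fun e he => ?_
    rw [mul_sum, Nat.cast_sum, ← sum_subset (range_subset_range.2 (mem_range.1 he).le)]
    · refine sum_congr rfl fun e' he' => ?_
      have h1 := mem_range.1 he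
      have h2 := mem_range.1 he'
      simp only [h2, true_and]
      split_ifs
      · push_cast [h1.le, h2.le]
        ring
      · simp
    · intro e' _ he'
      rw [mem_range] at he'
      simp [he']
  zify at this ⊢
  rw [this]
  push_cast at h ⊢
  rw [h]
  ring

theorem Good.two_ne {m : ℕ} (hm : 0 < m) (p : ℕ × ℕ) (h : Good m p) : p.2 ≠ 0 ∧ p.2 ≠ p.1 := by
  obtain ⟨e, e', rfl, h⟩ := h
  rw [oppResidues_iff] at h
  refine ⟨mul_ne_zero hm.ne' (by omega), fun h1 => ?_⟩
  have := Nat.eq_of_mul_eq_mul_left hm h1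
  omega

theorem ncard_KapSet_eq_card_digitQuads {m n : ℕ} (hm : Odd m) (hm1 : 1 < m) :
    (KapSet (5 * m * 2 ^ n)).ncard = #(digitQuads (5 * m * 2 ^ n) (Good m)) := by
  have hb : 0 < 5 * m * 2 ^ n := by positivity
  have hmem := fun x => mem_KapSet_iff (n := n) (x := x) hm hm1
  generalize 5 * m * 2 ^ n = b at *
  have h : KapSet b = ↑((digitQuads b (Good m)).image
      fun t => ofDigits4 b t.1 t.2.1 t.2.2.1 t.2.2.2) := by
    ext x
    rw [hmem, mem_coe, mem_image]
    constructor
    · rintro ⟨hx, hg⟩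
      exact ⟨(x % b, x / b % b, x / b ^ 2 % b, x / b ^ 3 % b), mem_digitQuads.2
        ⟨⟨Nat.mod_lt _ hb, Nat.mod_lt _ hb, Nat.mod_lt _ hb, Nat.mod_lt _ hb⟩, hg⟩,
        ofDigits4_digits b x hx⟩
    · rintro ⟨⟨w, x, y, z⟩, ht, rfl⟩
      obtain ⟨⟨hw, hx, hy, hz⟩, hg⟩ := mem_digitQuads.1 ht
      exact ⟨ofDigits4_lt hw hx hy hz, by rwa [diffPair_ofDigits4 hw hx hy hz]⟩
  rw [h, Set.ncard_coe_finset, card_image_of_injOn]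
  rintro ⟨w, x, y, z⟩ ht ⟨w', x', y', z'⟩ ht' heq
  obtain ⟨⟨hw, hx, hy, hz⟩, -⟩ := mem_digitQuads.1 ht
  obtain ⟨⟨hw', hx', hy', hz'⟩, -⟩ := mem_digitQuads.1 ht'
  have h1 := digits_ofDigits4 hw hx hy hz
  have h2 := digits_ofDigits4 hw' hx' hy' hz'
  dsimp only at heq
  rw [heq] at h1
  simp only [Prod.mk.injEq]
  omega

theorem ncard_KapSet {m n : ℕ} (hm : Odd m) (hm1 : 1 < m) :
    (KapSet (5 * m * 2 ^ n)).ncard = 40 * 4 ^ n * m ^ 2 * (1 + 5 * 4 ^ n) := by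
  have hm0 : 0 < m := by omega
  rw [ncard_KapSet_eq_card_digitQuads hm hm1,
    card_digitQuads_eq_six_mul fun p h => (Good.two_ne hm0 p h).1,
    card_frontAbove fun p h => (Good.two_ne hm0 p h).2,
    show 5 * m * 2 ^ n = m * (5 * 2 ^ n) by ring, card_decreasingLeft hm0,
    card_decreasingRight hm0, card_quadParams]
  have h := three_mul_sum_oppPairs (2 ^ n)
  rw [← pow_mul, mul_comm n, pow_mul] at h
  linear_combination 8 * m ^ 2 * h

/-- if `b = 5m·2^n` with `m > 1` odd, then
`|S_b| = 40·4^n·m²·(1 + 5·4^n)`; equivalently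
`|S_b|/b⁴ = (8 + 40·4^n)/(5b²) = 8/(5b²) + 8/(25m²)`. -/
theorem kaprekar_proportion (m n b : ℕ) (hm : Odd m) (hm1 : 1 < m)
    (hb : b = 5 * m * 2 ^ n) :
    (KapSet b).ncard = 40 * 4 ^ n * m ^ 2 * (1 + 5 * 4 ^ n) ∧
    ((KapSet b).ncard : ℚ) / (b : ℚ) ^ 4 = (8 + 40 * 4 ^ n) / (5 * (b : ℚ) ^ 2) ∧
    ((KapSet b).ncard : ℚ) / (b : ℚ) ^ 4
      = 8 / (5 * (b : ℚ) ^ 2) + 8 / (25 * (m : ℚ) ^ 2) := by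
  subst hb
  have hm0 : (m : ℚ) ≠ 0 := by exact_mod_cast (by omega : m ≠ 0)
  have h4 : (4 : ℚ) ^ n = (2 ^ n) ^ 2 := by rw [← pow_mul, mul_comm, pow_mul]; norm_num
  refine ⟨ncard_KapSet hm hm1, ?_, ?_⟩ <;> rw [ncard_KapSet hm hm1] <;> push_cast <;>
    rw [h4] <;> field_simp <;> ring
end

section
/- Let b = 5·2^n with n ≥ 2. Let (u, v) be a base-b difference pair and suppose L ≥ 0 is such that K^L(u, v) = (p·2^n, q·2^n) for some integers 0 ≤ q ≤ p ≤ 4, while for every t with 0 ≤ t < L the pair K^t(u, v) does not have both coordinates divisible by 2^n. Then: L = 0 if (p, q) = (3, 1) or p = q; L ≤ n if (p, q) ∈ {(4, 1), (3, 0), (4, 0)}; L ≤ 2n if (p, q) ∈ {(4, 2), (2, 0)}; and L ≤ 2n + 2 if (p, q) ∈ {(1, 0), (2, 1), (3, 2), (4, 3)}. -/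
/-- The action of a type (a) step on a single coordinate. -/
def fold (b x : ℕ) : ℕ := (2 * (x : ℤ) - (b : ℤ)).natAbs

/-- A difference pair of type (a). -/
def IsTypeA (b : ℕ) (p : ℕ × ℕ) : Prop := p.2 < p.1 ∧ 0 < p.2 ∧ p.1 + p.2 ≠ b

/-- A difference pair of type (b). -/
def IsTypeB (b : ℕ) (p : ℕ × ℕ) : Prop := 0 < p.2 ∧ (p.1 = p.2 ∨ p.1 + p.2 = b)

/-- A difference pair of type (c). -/
def IsTypeC (p : ℕ × ℕ) : Prop := 0 < p.1 ∧ p.2 = 0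

lemma sort2_cases (x y : ℕ) :
    (sort2 (x, y) = (x, y) ∧ y ≤ x) ∨ (sort2 (x, y) = (y, x) ∧ x ≤ y) := by
  rcases le_total x y with h | h
  · right; simp [sort2, h]
  · left; simp [sort2, h]

lemma sort2_comm (x y : ℕ) : sort2 (x, y) = sort2 (y, x) := by
  simp [sort2, max_comm, min_comm]

lemma sort2_of_le {p : ℕ × ℕ} (h : p.2 ≤ p.1) : sort2 (p.1, p.2) = p := by
  simp [sort2, h]

lemma Kpair_typeA {b : ℕ} {p : ℕ × ℕ} (h : IsTypeA b p) :
    Kpair b p = sort2 (fold b p.1, fold b p.2) := by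
  obtain ⟨h1, h2, h3⟩ := h
  rw [Kpair, if_neg (by omega), if_neg (by omega), if_neg (by omega)]
  rfl

lemma Kpair_typeB {b : ℕ} {p : ℕ × ℕ} (h : IsTypeB b p) :
    Kpair b p = sort2 ((2 * (p.1 : ℤ) - ((b : ℤ) - 1)).natAbs,
      (2 * (p.1 : ℤ) - ((b : ℤ) + 1)).natAbs) := by
  obtain ⟨h1, h2⟩ := h
  rw [Kpair, if_neg (by omega), if_neg (by omega), if_pos h2]

lemma Kpair_typeC {b : ℕ} {p : ℕ × ℕ} (h : IsTypeC p) :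
    Kpair b p = sort2 (p.1 - 1, b - p.1) := by
  obtain ⟨h1, h2⟩ := h
  rw [Kpair, if_neg (by omega), if_pos h2]

lemma Kpair_typeB_of_pos {b : ℕ} {p : ℕ × ℕ} (h : IsTypeB b p) (h0 : 0 < fold b p.1) :
    Kpair b p = sort2 (fold b p.1 + 1, fold b p.1 - 1) := by
  rw [Kpair_typeB h]
  unfold fold at *
  rcases le_total b (2 * p.1) with h | h
  · congr 2 <;> omega
  · rw [sort2_comm]
    congr 2 <;> omega

lemma Kpair_typeB_of_zero {b : ℕ} {p : ℕ × ℕ} (h : IsTypeB b p) (h0 : fold b p.1 = 0) :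
    Kpair b p = (1, 1) := by
  rw [Kpair_typeB h]
  unfold fold at h0
  rw [show (2 * (p.1 : ℤ) - ((b : ℤ) - 1)).natAbs = 1 by omega,
    show (2 * (p.1 : ℤ) - ((b : ℤ) + 1)).natAbs = 1 by omega]
  rfl

/-- A type (b) step in an even base produces two odd coordinates. -/
lemma exists_odd_Kpair_typeB {b : ℕ} (hb : 2 ∣ b) {p : ℕ × ℕ} (h : IsTypeB b p) :
    ∃ x y, Kpair b p = sort2 (x, y) ∧ ¬ 2 ∣ x ∧ ¬ 2 ∣ y :=
  ⟨_, _, Kpair_typeB h, by omega, by omega⟩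

lemma isDiffPair_Kpair {b : ℕ} (hb : 2 ≤ b) {p : ℕ × ℕ} (h : IsDiffPair b p) :
    IsDiffPair b (Kpair b p) := by
  obtain ⟨h1, h2⟩ := h
  unfold Kpair sort2 IsDiffPair
  split_ifs with ha hc hB
  · simp
  · simp only; omega
  · simp only; omega
  · simp only; omega

lemma type_cases {b : ℕ} {p : ℕ × ℕ} (h : p.2 ≤ p.1) (h0 : p ≠ (0, 0)) :
    IsTypeA b p ∨ IsTypeB b p ∨ IsTypeC p := by
  obtain ⟨x, y⟩ := p
  simp only [ne_eq, Prod.mk.injEq] at h h0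
  unfold IsTypeA IsTypeB IsTypeC
  simp only
  omega

/-- A run of type (a) steps acts on each coordinate separately. -/
lemma iterate_Kpair_of_typeA {b x y k : ℕ}
    (h : ∀ i < k, IsTypeA b ((Kpair b)^[i] (sort2 (x, y)))) :
    (Kpair b)^[k] (sort2 (x, y)) = sort2 ((fold b)^[k] x, (fold b)^[k] y) := by
  induction k with
  | zero => rfl
  | succ k ih =>
    have hk := h k (Nat.lt_succ_self k)
    rw [Function.iterate_succ_apply', Function.iterate_succ_apply',
      Function.iterate_succ_apply', Kpair_typeA hk, ih fun i hi => h i (by omega)]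
    rcases sort2_cases ((fold b)^[k] x) ((fold b)^[k] y) with ⟨h', -⟩ | ⟨h', -⟩ <;> rw [h']
    rw [sort2_comm]

lemma two_pow_succ_dvd_fold_iff {n m : ℕ} (hm : m + 1 ≤ n) (x : ℕ) :
    2 ^ (m + 1) ∣ fold (5 * 2 ^ n) x ↔ 2 ^ m ∣ x := by
  have hd : (2 : ℤ) ^ (m + 1) ∣ 5 * 2 ^ n := (pow_dvd_pow 2 hm).mul_left 5
  unfold fold
  rw [← Int.natCast_dvd, ← Int.natCast_dvd_natCast (n := x)]
  push_cast
  rw [dvd_sub_left hd, pow_succ', mul_dvd_mul_iff_left two_ne_zero]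

lemma two_pow_add_dvd_iterate_fold_iff {n m j : ℕ} (h : m + j ≤ n) (x : ℕ) :
    2 ^ (m + j) ∣ (fold (5 * 2 ^ n))^[j] x ↔ 2 ^ m ∣ x := by
  induction j with
  | zero => rfl
  | succ j ih =>
    rw [Function.iterate_succ_apply', ← add_assoc, two_pow_succ_dvd_fold_iff (by omega),
      ih (by omega)]

lemma two_pow_dvd_iterate_fold {n j : ℕ} (h : j ≤ n) (x : ℕ) :
    2 ^ j ∣ (fold (5 * 2 ^ n))^[j] x := by
  simpa using (two_pow_add_dvd_iterate_fold_iff (m := 0) (by omega : 0 + j ≤ n) x).2 (by simp)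

lemma two_pow_succ_dvd_iterate_fold_iff {n j : ℕ} (h : j < n) (x : ℕ) :
    2 ^ (j + 1) ∣ (fold (5 * 2 ^ n))^[j] x ↔ 2 ∣ x := by
  simpa [add_comm] using two_pow_add_dvd_iterate_fold_iff (m := 1) (by omega : 1 + j ≤ n) x

lemma two_pow_succ_dvd_iterate_fold_self_iff {n : ℕ} (hn : 1 ≤ n) (x : ℕ) :
    2 ^ (n + 1) ∣ (fold (5 * 2 ^ n))^[n] x ↔ ¬ 2 ∣ x := by
  obtain ⟨m, rfl⟩ : ∃ m, n = m + 1 := ⟨n - 1, by omega⟩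
  rw [← two_pow_succ_dvd_iterate_fold_iff (Nat.lt_succ_self m) x, Function.iterate_succ_apply']
  obtain ⟨z, hz⟩ := two_pow_dvd_iterate_fold (Nat.le_succ m) x
  rw [hz]
  have key : fold (5 * 2 ^ (m + 1)) (2 ^ m * z) = 2 ^ (m + 1) * ((z : ℤ) - 5).natAbs := by
    unfold fold
    rw [show (2 * ((2 ^ m * z : ℕ) : ℤ) - ((5 * 2 ^ (m + 1) : ℕ) : ℤ)) =
      ((2 ^ (m + 1) : ℕ) : ℤ) * ((z : ℤ) - 5) by push_cast; ring, Int.natAbs_mul,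
      Int.natAbs_natCast]
  rw [key, pow_succ 2 (m + 1), pow_succ 2 m, Nat.mul_dvd_mul_iff_left (by positivity),
    Nat.mul_dvd_mul_iff_left (by positivity)]
  omega

lemma sq_fold (n x : ℕ) : ((fold (5 * 2 ^ n) x : ℕ) : ZMod 5) ^ 2 = 4 * (x : ZMod 5) ^ 2 := by
  have h : ((fold (5 * 2 ^ n) x : ℕ) : ℤ) ^ 2 = (2 * (x : ℤ) - 5 * 2 ^ n) ^ 2 := by
    unfold fold
    rw [Int.natAbs_sq]
    push_cast
    rfl
  have h' := congrArg (Int.cast : ℤ → ZMod 5) h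
  push_cast at h'
  rw [h', show (5 : ZMod 5) = 0 from rfl]
  ring

lemma sq_iterate_fold (n j x : ℕ) :
    (((fold (5 * 2 ^ n))^[j] x : ℕ) : ZMod 5) ^ 2 = 4 ^ j * (x : ZMod 5) ^ 2 := by
  induction j with
  | zero => simp
  | succ j ih => rw [Function.iterate_succ_apply', sq_fold, ih]; ring

lemma five_dvd_iterate_fold_iff (n j x : ℕ) : 5 ∣ (fold (5 * 2 ^ n))^[j] x ↔ 5 ∣ x := by
  have h4' : (4 : ZMod 5) ≠ 0 := by decide
  have : Fact (Nat.Prime 5) := ⟨by norm_num⟩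
  have h4 : (4 : ZMod 5) ^ j ≠ 0 := pow_ne_zero _ h4'
  rw [← ZMod.natCast_eq_zero_iff, ← ZMod.natCast_eq_zero_iff, ← sq_eq_zero_iff, sq_iterate_fold,
    mul_eq_zero, sq_eq_zero_iff]
  simp [h4]

lemma five_dvd_and_not_dvd_of_iterate_fold_eq_zero {n j x : ℕ} (hj : j < n)
    (h : (fold (5 * 2 ^ n))^[j + 1] x = 0) : 5 ∣ x ∧ ¬ 2 ^ (n - j) ∣ x := by
  refine ⟨(five_dvd_iterate_fold_iff n (j + 1) x).1 (by simp [h]), ?_⟩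
  rw [← two_pow_add_dvd_iterate_fold_iff (by omega : n - j + j ≤ n)]
  rw [Function.iterate_succ_apply'] at h
  rw [Nat.sub_add_cancel hj.le]
  rintro ⟨z, hz⟩
  rw [hz] at h
  unfold fold at h
  have h2 : (2 ^ n : ℤ) * (2 * z) = 2 ^ n * 5 := by
    have := Int.natAbs_eq_zero.1 h
    push_cast at this
    linarith
  have := mul_left_cancel₀ (by positivity) h2
  omega

lemma two_pow_dvd_iterate_Kpair {n k : ℕ} (hk : k ≤ n) {p : ℕ × ℕ} (hp : p.2 ≤ p.1)
    (hA : ∀ i < k, IsTypeA (5 * 2 ^ n) ((Kpair (5 * 2 ^ n))^[i] p)) :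
    2 ^ k ∣ ((Kpair (5 * 2 ^ n))^[k] p).1 ∧ 2 ^ k ∣ ((Kpair (5 * 2 ^ n))^[k] p).2 := by
  rw [← sort2_of_le hp] at hA ⊢
  rw [iterate_Kpair_of_typeA hA]
  have h1 := two_pow_dvd_iterate_fold hk p.1
  have h2 := two_pow_dvd_iterate_fold hk p.2
  rcases sort2_cases ((fold (5 * 2 ^ n))^[k] p.1) ((fold (5 * 2 ^ n))^[k] p.2)
    with ⟨h, -⟩ | ⟨h, -⟩ <;> rw [h]
  · exact ⟨h1, h2⟩
  · exact ⟨h2, h1⟩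

lemma two_dvd_five_mul_two_pow {n : ℕ} (hn : 1 ≤ n) : 2 ∣ 5 * 2 ^ n :=
  (dvd_pow_self 2 (by omega)).mul_left 5

/-- Type (c) does not follow type (b) after fewer than `n` steps of type (a). -/
lemma not_typeC_of_typeB {n k : ℕ} (hk : k < n) {p : ℕ × ℕ} (h : IsTypeB (5 * 2 ^ n) p)
    (hA : ∀ i < k, IsTypeA (5 * 2 ^ n) ((Kpair (5 * 2 ^ n))^[i] (Kpair (5 * 2 ^ n) p))) :
    ¬ IsTypeC ((Kpair (5 * 2 ^ n))^[k] (Kpair (5 * 2 ^ n) p)) := by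
  obtain ⟨x, y, e, hx, hy⟩ :=
    exists_odd_Kpair_typeB (two_dvd_five_mul_two_pow (by omega : 1 ≤ n)) h
  rw [e] at hA ⊢
  rw [iterate_Kpair_of_typeA hA]
  rw [← two_pow_succ_dvd_iterate_fold_iff hk] at hx hy
  rintro ⟨-, h0⟩
  rcases sort2_cases ((fold (5 * 2 ^ n))^[k] x) ((fold (5 * 2 ^ n))^[k] y)
    with ⟨h, -⟩ | ⟨h, -⟩ <;> rw [h] at h0 <;> simp only at h0
  · exact hy (h0 ▸ dvd_zero _)
  · exact hx (h0 ▸ dvd_zero _)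

/-- Type (b) does not follow type (c) after fewer than `n` steps of type (a). -/
lemma not_typeB_of_typeC {n k : ℕ} (hk : k < n) {p : ℕ × ℕ} (h : IsTypeC p)
    (hp : p.1 < 5 * 2 ^ n)
    (hA : ∀ i < k, IsTypeA (5 * 2 ^ n) ((Kpair (5 * 2 ^ n))^[i] (Kpair (5 * 2 ^ n) p))) :
    ¬ IsTypeB (5 * 2 ^ n) ((Kpair (5 * 2 ^ n))^[k] (Kpair (5 * 2 ^ n) p)) := by
  have h2 := two_dvd_five_mul_two_pow (by omega : 1 ≤ n)
  have hdvd : 2 ^ (k + 1) ∣ 5 * 2 ^ n := (pow_dvd_pow 2 hk).mul_left 5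
  rw [Kpair_typeC h] at hA ⊢
  rw [iterate_Kpair_of_typeA hA]
  have hx := two_pow_succ_dvd_iterate_fold_iff hk (p.1 - 1)
  have hy := two_pow_succ_dvd_iterate_fold_iff hk (5 * 2 ^ n - p.1)
  generalize (fold (5 * 2 ^ n))^[k] (p.1 - 1) = X at *
  generalize (fold (5 * 2 ^ n))^[k] (5 * 2 ^ n - p.1) = Y at *
  have hne : ¬ (2 ^ (k + 1) ∣ X ↔ 2 ^ (k + 1) ∣ Y) := by
    rw [hx, hy]
    have := h.1
    omega
  rintro ⟨-, hB⟩
  have hB' : X = Y ∨ X + Y = 5 * 2 ^ n := by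
    rcases sort2_cases X Y with ⟨h, -⟩ | ⟨h, -⟩ <;> rw [h] at hB <;> simp only at hB <;> omega
  rcases hB' with rfl | hB'
  · exact hne Iff.rfl
  · refine hne ⟨fun h => ?_, fun h => ?_⟩
    · exact (Nat.dvd_add_right h).1 (hB' ▸ hdvd)
    · exact (Nat.dvd_add_left h).1 (hB' ▸ hdvd)

/-- The orbit of a pair `(x + 1, x - 1)` with `x` even, along a run of type (a) steps. -/
lemma iterate_Kpair_add_sub_one {n x : ℕ} (hx : 0 < x) (h2 : 2 ∣ x) {k : ℕ} (hk : k < n)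
    (hA : ∀ i < k, IsTypeA (5 * 2 ^ n) ((Kpair (5 * 2 ^ n))^[i] (sort2 (x + 1, x - 1)))) :
    (Kpair (5 * 2 ^ n))^[k] (sort2 (x + 1, x - 1)) =
      ((fold (5 * 2 ^ n))^[k] x + 2 ^ k, (fold (5 * 2 ^ n))^[k] x - 2 ^ k) ∧
    2 ^ k < (fold (5 * 2 ^ n))^[k] x := by
  induction k with
  | zero =>
    refine ⟨?_, by simp; omega⟩
    simp only [Function.iterate_zero, id, pow_zero, sort2]
    congr 1 <;> omega
  | succ k ih =>
    obtain ⟨e, hlt⟩ := ih (by omega) fun i hi => hA i (by omega)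
    have hAk := hA k (Nat.lt_succ_self k)
    have hdvd := (two_pow_succ_dvd_iterate_fold_iff hk x).2 h2
    rw [Function.iterate_succ_apply'] at hdvd ⊢
    rw [Function.iterate_succ_apply', Kpair_typeA hAk]
    rw [e] at hAk ⊢
    obtain ⟨-, -, hne⟩ := hAk
    simp only at hne
    generalize (fold (5 * 2 ^ n))^[k] x = y at *
    have hpos : 0 < fold (5 * 2 ^ n) y := by
      unfold fold
      omega
    have hle := Nat.le_of_dvd hpos hdvd
    rw [pow_succ, pow_succ] at hle
    rw [pow_succ]
    have h0 : 0 < 2 ^ k := by positivity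
    generalize 2 ^ k = w at *
    generalize 5 * 2 ^ n = b at *
    refine ⟨?_, by omega⟩
    unfold fold at *
    simp only [sort2]
    congr 1 <;> omega

/-- Two consecutive steps of type (b), separated by `k` steps of type (a). -/
lemma typeB_of_typeB {n k : ℕ} (hk : k < n) {p r : ℕ × ℕ} (h : IsTypeB (5 * 2 ^ n) p)
    (hA : ∀ i < k, IsTypeA (5 * 2 ^ n) ((Kpair (5 * 2 ^ n))^[i] (Kpair (5 * 2 ^ n) p)))
    (hr : (Kpair (5 * 2 ^ n))^[k] (Kpair (5 * 2 ^ n) p) = r) (hB : IsTypeB (5 * 2 ^ n) r) :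
    ¬ 5 ∣ fold (5 * 2 ^ n) r.1 ∧ ((fold (5 * 2 ^ n) p.1 = 0 ∧ k = 0) ∨
      (5 ∣ fold (5 * 2 ^ n) p.1 ∧ ¬ 2 ^ (n - k) ∣ fold (5 * 2 ^ n) p.1)) := by
  have h2 := two_dvd_five_mul_two_pow (by omega : 1 ≤ n)
  rcases Nat.eq_zero_or_pos (fold (5 * 2 ^ n) p.1) with h0 | h0
  · rw [Kpair_typeB_of_zero h h0] at hA hr
    have hk0 : k = 0 := by
      by_contra hne
      have := hA 0 (by omega)
      simp [IsTypeA] at this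
    subst hk0
    subst hr
    refine ⟨?_, Or.inl ⟨h0, rfl⟩⟩
    simp only [Function.iterate_zero, id, fold]
    omega
  · rw [Kpair_typeB_of_pos h h0] at hA hr
    obtain ⟨e, hlt⟩ := iterate_Kpair_add_sub_one h0 (by unfold fold; omega) hk hA
    rw [hr] at e
    subst e
    obtain ⟨-, hB⟩ := hB
    have hw : 0 < 2 ^ k := by positivity
    have hsum : 2 * (fold (5 * 2 ^ n))^[k] (fold (5 * 2 ^ n) p.1) = 5 * 2 ^ n := by
      simp only at hB
      omega
    constructor
    · have : fold (5 * 2 ^ n)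
          ((fold (5 * 2 ^ n))^[k] (fold (5 * 2 ^ n) p.1) + 2 ^ k) = 2 ^ (k + 1) := by
        rw [pow_succ, fold]
        omega
      simp only [this]
      intro h5
      have := Nat.Prime.dvd_of_dvd_pow (by norm_num) h5
      omega
    · right
      apply five_dvd_and_not_dvd_of_iterate_fold_eq_zero hk
      rw [Function.iterate_succ_apply', fold]
      omega

/-- Two consecutive steps of type (c), separated by `k` steps of type (a). -/
lemma typeC_of_typeC {n k : ℕ} (hk : k < n) {p r : ℕ × ℕ} (h : IsTypeC p)
    (hp : p.1 < 5 * 2 ^ n)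
    (hA : ∀ i < k, IsTypeA (5 * 2 ^ n) ((Kpair (5 * 2 ^ n))^[i] (Kpair (5 * 2 ^ n) p)))
    (hr : (Kpair (5 * 2 ^ n))^[k] (Kpair (5 * 2 ^ n) p) = r) (hC : IsTypeC r) :
    ¬ 5 ∣ r.1 ∧ (2 ∣ r.1 ∨ r.1 = 5 * 2 ^ n - 1) ∧
      ((¬ 2 ∣ p.1 ∧ p.1 % 5 = 1) ∨ (5 ∣ p.1 ∧ ¬ 2 ^ (n - k + 1) ∣ p.1)) := by
  have hp1 := h.1
  rw [Kpair_typeC h] at hA hr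
  rw [iterate_Kpair_of_typeA hA] at hr
  subst hr
  have key : ((fold (5 * 2 ^ n))^[k] (p.1 - 1) = 0 ∧
      sort2 ((fold (5 * 2 ^ n))^[k] (p.1 - 1), (fold (5 * 2 ^ n))^[k] (5 * 2 ^ n - p.1)) =
        ((fold (5 * 2 ^ n))^[k] (5 * 2 ^ n - p.1), (fold (5 * 2 ^ n))^[k] (p.1 - 1))) ∨
      ((fold (5 * 2 ^ n))^[k] (5 * 2 ^ n - p.1) = 0 ∧
      sort2 ((fold (5 * 2 ^ n))^[k] (p.1 - 1), (fold (5 * 2 ^ n))^[k] (5 * 2 ^ n - p.1)) =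
        ((fold (5 * 2 ^ n))^[k] (p.1 - 1), (fold (5 * 2 ^ n))^[k] (5 * 2 ^ n - p.1))) := by
    obtain ⟨-, hC⟩ := hC
    rcases sort2_cases ((fold (5 * 2 ^ n))^[k] (p.1 - 1))
      ((fold (5 * 2 ^ n))^[k] (5 * 2 ^ n - p.1)) with ⟨h, -⟩ | ⟨h, -⟩ <;> rw [h] at hC
    · exact Or.inr ⟨hC, h⟩
    · exact Or.inl ⟨hC, h⟩
  rcases key with ⟨h0, e⟩ | ⟨h0, e⟩ <;> rw [e] <;> simp only [five_dvd_iterate_fold_iff]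
  · have h5 := (five_dvd_iterate_fold_iff n k (p.1 - 1)).1 (h0 ▸ dvd_zero _)
    have h2 := (two_pow_succ_dvd_iterate_fold_iff hk (p.1 - 1)).1 (h0 ▸ dvd_zero _)
    refine ⟨by omega, ?_, Or.inl (by omega)⟩
    rcases k with _ | j
    · right
      simp only [Function.iterate_zero, id] at h0 ⊢
      omega
    · left
      exact (dvd_pow_self 2 (by omega)).trans (two_pow_dvd_iterate_fold hk.le _)
  · rcases k with _ | j
    · simp only [Function.iterate_zero, id] at h0
      omega
    · obtain ⟨h5, hn⟩ := five_dvd_and_not_dvd_of_iterate_fold_eq_zero (by omega) h0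
      refine ⟨by omega, Or.inl ?_, Or.inr ⟨by omega, ?_⟩⟩
      · exact (dvd_pow_self 2 (by omega)).trans (two_pow_dvd_iterate_fold hk.le _)
      · rw [show n - (j + 1) + 1 = n - j by omega]
        exact fun hd => hn (Nat.dvd_sub ((pow_dvd_pow 2 (by omega)).mul_left 5) hd)

/-- The arithmetic of a single coordinate along `n` steps of type (a). -/
lemma iterate_fold_eq_mul_two_pow {n : ℕ} (hn : 1 ≤ n) {x a : ℕ}
    (h : (fold (5 * 2 ^ n))^[n] x = a * 2 ^ n) :
    (2 ∣ a ↔ ¬ 2 ∣ x) ∧ (a : ZMod 5) ^ 2 = (x : ZMod 5) ^ 2 := by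
  constructor
  · rw [← two_pow_succ_dvd_iterate_fold_self_iff hn, h, pow_succ', Nat.mul_dvd_mul_iff_right]
    positivity
  · have h4' : (4 : ZMod 5) ≠ 0 := by decide
    have : Fact (Nat.Prime 5) := ⟨by norm_num⟩
    have h4 : (4 : ZMod 5) ^ n ≠ 0 := pow_ne_zero _ h4'
    have hs := sq_iterate_fold n n x
    rw [h] at hs
    apply mul_left_cancel₀ h4
    rw [← hs]
    push_cast
    rw [mul_pow, ← pow_mul, mul_comm n 2, pow_mul, mul_comm]
    norm_num

/-- The possible ends of a run of `n` steps of type (a). -/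
lemma iterate_Kpair_eq_mul_two_pow {n x y a c : ℕ} (hn : 1 ≤ n)
    (hA : ∀ i < n, IsTypeA (5 * 2 ^ n) ((Kpair (5 * 2 ^ n))^[i] (sort2 (x, y))))
    (h : (Kpair (5 * 2 ^ n))^[n] (sort2 (x, y)) = (a * 2 ^ n, c * 2 ^ n)) :
    ((2 ∣ a ↔ ¬ 2 ∣ x) ∧ (2 ∣ c ↔ ¬ 2 ∣ y) ∧
      (a : ZMod 5) ^ 2 = (x : ZMod 5) ^ 2 ∧ (c : ZMod 5) ^ 2 = (y : ZMod 5) ^ 2) ∨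
    ((2 ∣ a ↔ ¬ 2 ∣ y) ∧ (2 ∣ c ↔ ¬ 2 ∣ x) ∧
      (a : ZMod 5) ^ 2 = (y : ZMod 5) ^ 2 ∧ (c : ZMod 5) ^ 2 = (x : ZMod 5) ^ 2) := by
  rw [iterate_Kpair_of_typeA hA] at h
  rcases sort2_cases ((fold (5 * 2 ^ n))^[n] x) ((fold (5 * 2 ^ n))^[n] y)
    with ⟨h', -⟩ | ⟨h', -⟩ <;> rw [h', Prod.mk.injEq] at h
  · have h1 := iterate_fold_eq_mul_two_pow hn h.1
    have h2 := iterate_fold_eq_mul_two_pow hn h.2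
    exact Or.inl ⟨h1.1, h2.1, h1.2, h2.2⟩
  · have h1 := iterate_fold_eq_mul_two_pow hn h.1
    have h2 := iterate_fold_eq_mul_two_pow hn h.2
    exact Or.inr ⟨h1.1, h2.1, h1.2, h2.2⟩

lemma natAbs_cast_sq (m : ℤ) : ((m.natAbs : ℕ) : ZMod 5) ^ 2 = (m : ZMod 5) ^ 2 := by
  rw [← Int.cast_natCast (R := ZMod 5), ← Int.cast_pow, Int.natAbs_sq, Int.cast_pow]

lemma typeB_end {n : ℕ} (hn : 1 ≤ n) {p : ℕ × ℕ} {a c : ℕ} (h : IsTypeB (5 * 2 ^ n) p)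
    (hA : ∀ i < n, IsTypeA (5 * 2 ^ n) ((Kpair (5 * 2 ^ n))^[i] (Kpair (5 * 2 ^ n) p)))
    (he : (Kpair (5 * 2 ^ n))^[n] (Kpair (5 * 2 ^ n) p) = (a * 2 ^ n, c * 2 ^ n)) :
    2 ∣ a ∧ 2 ∣ c ∧ (a, c) ≠ (4, 0) := by
  have h2 := two_dvd_five_mul_two_pow hn
  rw [Kpair_typeB h] at hA he
  have hmod := iterate_Kpair_eq_mul_two_pow hn hA he
  refine ⟨by omega, by omega, ?_⟩
  rw [ne_eq, Prod.mk.injEq]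
  rintro ⟨rfl, rfl⟩
  simp only [natAbs_cast_sq] at hmod
  push_cast at hmod
  rw [show (5 : ZMod 5) = 0 from rfl, zero_mul] at hmod
  generalize (p.1 : ZMod 5) = z at hmod
  rcases hmod with ⟨-, -, h⟩ | ⟨-, -, h⟩ <;> revert z <;> decide

lemma typeC_end {n : ℕ} (hn : 1 ≤ n) {p : ℕ × ℕ} {a c : ℕ} (h : IsTypeC p)
    (hp : p.1 < 5 * 2 ^ n)
    (hA : ∀ i < n, IsTypeA (5 * 2 ^ n) ((Kpair (5 * 2 ^ n))^[i] (Kpair (5 * 2 ^ n) p)))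
    (he : (Kpair (5 * 2 ^ n))^[n] (Kpair (5 * 2 ^ n) p) = (a * 2 ^ n, c * 2 ^ n)) :
    (2 ∣ a ↔ ¬ 2 ∣ c) ∧ (a, c) ≠ (4, 1) ∧ (a, c) ≠ (3, 0) := by
  have h2 := two_dvd_five_mul_two_pow hn
  have hp1 := h.1
  rw [Kpair_typeC h] at hA he
  have hmod := iterate_Kpair_eq_mul_two_pow hn hA he
  refine ⟨by omega, ?_⟩
  rw [ne_eq, ne_eq, Prod.mk.injEq, Prod.mk.injEq]
  rw [Nat.cast_sub hp1, Nat.cast_sub hp.le] at hmod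
  push_cast at hmod
  rw [show (5 : ZMod 5) = 0 from rfl, zero_mul] at hmod
  generalize (p.1 : ZMod 5) = z at hmod
  constructor <;> rintro ⟨rfl, rfl⟩ <;>
    rcases hmod with ⟨-, -, h⟩ | ⟨-, -, h⟩ <;> revert z <;> decide

lemma ne_zero_of_not_dvd {m : ℕ} {p : ℕ × ℕ} (h : ¬ (m ∣ p.1 ∧ m ∣ p.2)) : p ≠ (0, 0) := by
  rintro rfl
  simp at h

lemma isDiffPair_iterate_Kpair {b : ℕ} (hb : 2 ≤ b) {p : ℕ × ℕ} (h : IsDiffPair b p) (t : ℕ) :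
    IsDiffPair b ((Kpair b)^[t] p) := by
  induction t with
  | zero => exact h
  | succ t ih =>
    rw [Function.iterate_succ_apply']
    exact isDiffPair_Kpair hb ih

/-- The last step before time `T` that is not of type (a), if there is one. -/
lemma exists_last_not_typeA {b : ℕ} {p : ℕ × ℕ} {T : ℕ}
    (h : ∀ t < T, IsTypeA b ((Kpair b)^[t] p) ∨ IsTypeB b ((Kpair b)^[t] p) ∨
      IsTypeC ((Kpair b)^[t] p)) :
    (∀ t < T, IsTypeA b ((Kpair b)^[t] p)) ∨ ∃ s k, T = k + (s + 1) ∧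
      (IsTypeB b ((Kpair b)^[s] p) ∨ IsTypeC ((Kpair b)^[s] p)) ∧
      ∀ i < k, IsTypeA b ((Kpair b)^[i] (Kpair b ((Kpair b)^[s] p))) := by
  induction T with
  | zero => left; simp
  | succ T ih =>
    rcases h T (Nat.lt_succ_self T) with hT | hT
    · rcases ih fun t ht => h t (by omega) with hA | ⟨s, k, rfl, hs, hA⟩
      · left
        intro t ht
        rcases Nat.lt_succ_iff_lt_or_eq.1 ht with ht | rfl
        · exact hA t ht
        · exact hT
      · refine Or.inr ⟨s, k + 1, by omega, hs, fun i hi => ?_⟩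
        rcases Nat.lt_succ_iff_lt_or_eq.1 hi with hi | rfl
        · exact hA i hi
        · rwa [Function.iterate_add_apply, Function.iterate_succ_apply'] at hT
    · exact Or.inr ⟨T, 0, by omega, hT, by simp⟩

/-- Before reaching a pair divisible by `2 ^ n`, an orbit either consists of at most `n` steps of
type (a), or has a last step of type (b) or (c) followed by at most `n` steps of type (a). -/
lemma typeA_or_exists_last {n : ℕ} {p : ℕ × ℕ} (hp : IsDiffPair (5 * 2 ^ n) p)
    {T : ℕ}
    (h : ∀ t < T, ¬ (2 ^ n ∣ ((Kpair (5 * 2 ^ n))^[t] p).1 ∧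
      2 ^ n ∣ ((Kpair (5 * 2 ^ n))^[t] p).2)) :
    (T ≤ n ∧ ∀ t < T, IsTypeA (5 * 2 ^ n) ((Kpair (5 * 2 ^ n))^[t] p)) ∨
      ∃ s k, T = k + (s + 1) ∧ k ≤ n ∧
      ((Kpair (5 * 2 ^ n))^[s] p).1 < 5 * 2 ^ n ∧
      2 ^ k ∣ ((Kpair (5 * 2 ^ n))^[T] p).1 ∧ 2 ^ k ∣ ((Kpair (5 * 2 ^ n))^[T] p).2 ∧
      (Kpair (5 * 2 ^ n))^[T] p =
        (Kpair (5 * 2 ^ n))^[k] (Kpair (5 * 2 ^ n) ((Kpair (5 * 2 ^ n))^[s] p)) ∧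
      (IsTypeB (5 * 2 ^ n) ((Kpair (5 * 2 ^ n))^[s] p) ∨
        IsTypeC ((Kpair (5 * 2 ^ n))^[s] p)) ∧
      ∀ i < k, IsTypeA (5 * 2 ^ n)
        ((Kpair (5 * 2 ^ n))^[i] (Kpair (5 * 2 ^ n) ((Kpair (5 * 2 ^ n))^[s] p))) := by
  have hN : 0 < 2 ^ n := by positivity
  have hD := isDiffPair_iterate_Kpair (by omega) hp
  rcases exists_last_not_typeA fun t ht => type_cases (hD t).1 (ne_zero_of_not_dvd (h t ht))
    with hA | ⟨s, k, rfl, hs, hA⟩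
  · refine Or.inl ⟨?_, hA⟩
    by_contra! hlt
    exact h n hlt (two_pow_dvd_iterate_Kpair le_rfl hp.1 fun i hi => hA i (by omega))
  · have e (i : ℕ) : (Kpair (5 * 2 ^ n))^[i + (s + 1)] p =
        (Kpair (5 * 2 ^ n))^[i] (Kpair (5 * 2 ^ n) ((Kpair (5 * 2 ^ n))^[s] p)) := by
      rw [Function.iterate_add_apply, Function.iterate_succ_apply']
    have hd := (isDiffPair_Kpair (by omega) (hD s)).1
    have hk : k ≤ n := by
      by_contra! hlt
      have := h (n + (s + 1)) (by omega)
      rw [e] at this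
      exact this (two_pow_dvd_iterate_Kpair le_rfl hd fun i hi => hA i (by omega))
    have hdvd := two_pow_dvd_iterate_Kpair hk hd hA
    rw [← e] at hdvd
    have := (hD s).2
    exact Or.inr ⟨s, k, rfl, hk, by omega, hdvd.1, hdvd.2, e k, hs, hA⟩

/-- The pair `(b / 2, b / 2)` is not reached by a step of type (a). -/
lemma fold_ne_zero_of_typeA {b : ℕ} {p : ℕ × ℕ} (h : IsTypeA b p) (hB : IsTypeB b (Kpair b p)) :
    fold b (Kpair b p).1 ≠ 0 := by
  rw [Kpair_typeA h] at *
  obtain ⟨h1, h2, h3⟩ := h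
  obtain ⟨h4, h5⟩ := hB
  unfold fold sort2 at *
  simp only at *
  omega

/-- A step of type (b) happens before time `n`. -/
lemma typeB_time_lt {n : ℕ} (hn : 2 ≤ n) {p : ℕ × ℕ} (hp : IsDiffPair (5 * 2 ^ n) p) {s : ℕ}
    (h : ∀ t ≤ s, ¬ (2 ^ n ∣ ((Kpair (5 * 2 ^ n))^[t] p).1 ∧
      2 ^ n ∣ ((Kpair (5 * 2 ^ n))^[t] p).2))
    (hB : IsTypeB (5 * 2 ^ n) ((Kpair (5 * 2 ^ n))^[s] p)) : s < n := by
  rcases typeA_or_exists_last hp (T := s) fun t ht => h t (by omega)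
    with ⟨hs, hA⟩ | ⟨s', k, rfl, hk, hlt, hd1, hd2, e, hs', hA⟩
  · refine hs.lt_of_ne ?_
    rintro rfl
    exact h s le_rfl (two_pow_dvd_iterate_Kpair le_rfl hp.1 hA)
  replace hk : k < n := hk.lt_of_ne fun hkn =>
    h _ le_rfl ⟨(pow_dvd_pow 2 hkn.ge).trans hd1, (pow_dvd_pow 2 hkn.ge).trans hd2⟩
  rw [e] at hB
  rcases hs' with hs' | hs'
  swap
  · exact absurd hB (not_typeB_of_typeC hk hs' hlt hA)
  obtain ⟨-, hX⟩ := typeB_of_typeB hk hs' hA rfl hB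
  rcases typeA_or_exists_last hp (T := s') fun t ht => h t (by omega)
    with ⟨hs, hA'⟩ | ⟨r, j, rfl, hj, hlt', hd1', hd2', e', hr, hA'⟩
  · rcases hX with ⟨hX, rfl⟩ | ⟨-, hX⟩
    · rcases s' with _ | m
      · omega
      · rw [Function.iterate_succ_apply'] at hX hs'
        exact absurd hX (fold_ne_zero_of_typeA (hA' m (by omega)) hs')
    · have hd := (two_pow_dvd_iterate_Kpair hs hp.1 hA').1
      obtain ⟨m, hm⟩ : ∃ m, n - k = m + 1 := ⟨n - k - 1, by omega⟩
      rw [hm, two_pow_succ_dvd_fold_iff (by omega)] at hX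
      by_contra hcon
      exact hX ((pow_dvd_pow 2 (by omega)).trans hd)
  · replace hj : j < n := hj.lt_of_ne fun hjn =>
      h (j + (r + 1)) (by omega)
        ⟨(pow_dvd_pow 2 hjn.ge).trans hd1', (pow_dvd_pow 2 hjn.ge).trans hd2'⟩
    rcases hr with hr | hr
    · have := (typeB_of_typeB hj hr hA' e'.symm hs').1
      rcases hX with ⟨hX, -⟩ | ⟨hX, -⟩
      · exact absurd (hX ▸ dvd_zero 5) this
      · exact absurd hX this
    · rw [e'] at hs'
      exact absurd hs' (not_typeB_of_typeC hj hr hlt' hA')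

/-- A step of type (c) happens no later than at time `n + 1`. -/
lemma typeC_time_le {n : ℕ} {p : ℕ × ℕ} (hp : IsDiffPair (5 * 2 ^ n) p) {s : ℕ}
    (h : ∀ t ≤ s, ¬ (2 ^ n ∣ ((Kpair (5 * 2 ^ n))^[t] p).1 ∧
      2 ^ n ∣ ((Kpair (5 * 2 ^ n))^[t] p).2))
    (hC : IsTypeC ((Kpair (5 * 2 ^ n))^[s] p)) : s ≤ n + 1 := by
  rcases typeA_or_exists_last hp (T := s) fun t ht => h t (by omega)
    with ⟨hs, hA⟩ | ⟨s', k, rfl, hk, hlt, hd1, hd2, e, hs', hA⟩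
  · omega
  replace hk : k < n := hk.lt_of_ne fun hkn =>
    h _ le_rfl ⟨(pow_dvd_pow 2 hkn.ge).trans hd1, (pow_dvd_pow 2 hkn.ge).trans hd2⟩
  rw [e] at hC
  rcases hs' with hs' | hs'
  · exact absurd hC (not_typeC_of_typeB hk hs' hA)
  obtain ⟨-, -, hX⟩ := typeC_of_typeC hk hs' hlt hA rfl hC
  rcases typeA_or_exists_last hp (T := s') fun t ht => h t (by omega)
    with ⟨hs, hA'⟩ | ⟨r, j, rfl, hj, hlt', hd1', hd2', e', hr, hA'⟩
  · have hd := (two_pow_dvd_iterate_Kpair hs hp.1 hA').1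
    rcases hX with ⟨hX, -⟩ | ⟨-, hX⟩
    · have : s' = 0 := by
        by_contra h0
        exact hX ((dvd_pow_self 2 h0).trans hd)
      omega
    · by_contra hcon
      exact hX ((pow_dvd_pow 2 (by omega)).trans hd)
  · replace hj : j < n := hj.lt_of_ne fun hjn =>
      h (j + (r + 1)) (by omega)
        ⟨(pow_dvd_pow 2 hjn.ge).trans hd1', (pow_dvd_pow 2 hjn.ge).trans hd2'⟩
    rcases hr with hr | hr
    · rw [e'] at hs'
      exact absurd hs' (not_typeC_of_typeB hj hr hA')
    · have := typeC_of_typeC hj hr hlt' hA' e'.symm hs'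
      have hN : 0 < 2 ^ n := by positivity
      omega

/-- Fewer than `n` steps of type (a) following one of type (b) or (c) do not lead to a pair
divisible by `2 ^ n`. -/
lemma not_two_pow_succ_dvd_iterate_Kpair {n k : ℕ} (hk : k < n) {p : ℕ × ℕ}
    (h : IsTypeB (5 * 2 ^ n) p ∨ IsTypeC p) (hp : p.1 < 5 * 2 ^ n)
    (hA : ∀ i < k, IsTypeA (5 * 2 ^ n) ((Kpair (5 * 2 ^ n))^[i] (Kpair (5 * 2 ^ n) p))) :
    ¬ (2 ^ (k + 1) ∣ ((Kpair (5 * 2 ^ n))^[k] (Kpair (5 * 2 ^ n) p)).1 ∧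
      2 ^ (k + 1) ∣ ((Kpair (5 * 2 ^ n))^[k] (Kpair (5 * 2 ^ n) p)).2) := by
  have h2 := two_dvd_five_mul_two_pow (by omega : 1 ≤ n)
  obtain ⟨x, y, e, hxy⟩ : ∃ x y, Kpair (5 * 2 ^ n) p = sort2 (x, y) ∧ ¬ (2 ∣ x ∧ 2 ∣ y) := by
    rcases h with h | h
    · obtain ⟨x, y, e, hx, -⟩ := exists_odd_Kpair_typeB h2 h
      exact ⟨x, y, e, fun h => hx h.1⟩
    · have := h.1
      exact ⟨_, _, Kpair_typeC h, by omega⟩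
  rw [e] at hA ⊢
  rw [iterate_Kpair_of_typeA hA]
  rw [← two_pow_succ_dvd_iterate_fold_iff hk, ← two_pow_succ_dvd_iterate_fold_iff hk] at hxy
  rcases sort2_cases ((fold (5 * 2 ^ n))^[k] x) ((fold (5 * 2 ^ n))^[k] y)
    with ⟨h, -⟩ | ⟨h, -⟩ <;> rw [h]
  · exact hxy
  · exact fun h => hxy h.symm

/-- A pair `(a * 2 ^ n, c * 2 ^ n)` with `a = c`, or with `a` and `c` odd, has no predecessors
other than pairs divisible by `2 ^ n`. -/
lemma ne_and_not_odd_of_Kpair_eq_mul_two_pow {n a c : ℕ} (hn : 1 ≤ n) {p : ℕ × ℕ}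
    (hp : IsDiffPair (5 * 2 ^ n) p) (h : ¬ (2 ^ n ∣ p.1 ∧ 2 ^ n ∣ p.2))
    (he : Kpair (5 * 2 ^ n) p = (a * 2 ^ n, c * 2 ^ n)) :
    a ≠ c ∧ ¬ (¬ 2 ∣ a ∧ ¬ 2 ∣ c) := by
  have h2 := two_dvd_five_mul_two_pow hn
  have hN : 0 < 2 ^ n := by positivity
  have hda : 2 ∣ a * 2 ^ n := (dvd_pow_self 2 (by omega)).mul_left a
  have hdc : 2 ∣ c * 2 ^ n := (dvd_pow_self 2 (by omega)).mul_left c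
  rcases type_cases hp.1 (ne_zero_of_not_dvd h) with hA | hB | hC
  · rw [Kpair_typeA hA] at he
    refine ⟨?_, ?_⟩
    · rintro rfl
      obtain ⟨h1, h2, h3⟩ := hA
      unfold fold sort2 at he
      rw [Prod.mk.injEq] at he
      omega
    · have key {x d : ℕ} (hx : fold (5 * 2 ^ n) x = d * 2 ^ n) (hd : ¬ 2 ∣ d) : 2 ^ n ∣ x := by
        have : (2 : ℤ) ^ n * 2 ∣ (2 ^ n * (d + 5) : ℤ) ∧
            (2 : ℤ) ^ n * 2 ∣ (2 ^ n * (5 - d) : ℤ) :=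
          ⟨mul_dvd_mul_left _ (by omega), mul_dvd_mul_left _ (by omega)⟩
        have hx2 : (2 : ℤ) ^ n * 2 ∣ x * 2 := by
          unfold fold at hx
          have hx' : (2 * (x : ℤ) - ((5 * 2 ^ n : ℕ) : ℤ)) = ((d * 2 ^ n : ℕ) : ℤ) ∨
              (2 * (x : ℤ) - ((5 * 2 ^ n : ℕ) : ℤ)) = -((d * 2 ^ n : ℕ) : ℤ) := by omega
          push_cast at hx'
          rcases hx' with hx' | hx'
          · rw [show (x : ℤ) * 2 = 2 ^ n * (d + 5) by linarith]
            exact this.1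
          · rw [show (x : ℤ) * 2 = 2 ^ n * (5 - d) by linarith]
            exact this.2
        exact_mod_cast Int.dvd_of_mul_dvd_mul_right (by norm_num) hx2
      rintro ⟨ha, hc⟩
      rcases sort2_cases (fold (5 * 2 ^ n) p.1) (fold (5 * 2 ^ n) p.2)
        with ⟨h', -⟩ | ⟨h', -⟩ <;> rw [h', Prod.mk.injEq] at he
      · exact h ⟨key he.1 ha, key he.2 hc⟩
      · exact h ⟨key he.2 hc, key he.1 ha⟩
  · rw [Kpair_typeB hB, sort2, Prod.mk.injEq] at he
    omega
  · rw [Kpair_typeC hC, sort2, Prod.mk.injEq] at he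
    have := hC.1
    have := hp.2
    omega

/-- upper bounds on the number of iterations before reaching a
difference pair with both coordinates divisible by `2^n` when `b = 5·2^n`. -/
theorem kaprekar_predecessor_length_bound (n b : ℕ) (hn : 2 ≤ n)
    (hb : b = 5 * 2 ^ n) (u v L p q : ℕ) (huv : IsDiffPair b (u, v))
    (hqp : q ≤ p) (hp4 : p ≤ 4)
    (hL : (Kpair b)^[L] (u, v) = (p * 2 ^ n, q * 2 ^ n))
    (hmin : ∀ t < L,
      ¬(2 ^ n ∣ ((Kpair b)^[t] (u, v)).1 ∧ 2 ^ n ∣ ((Kpair b)^[t] (u, v)).2)) :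
    (((p, q) = (3, 1) ∨ p = q) → L = 0) ∧
    (((p, q) = (4, 1) ∨ (p, q) = (3, 0) ∨ (p, q) = (4, 0)) → L ≤ n) ∧
    (((p, q) = (4, 2) ∨ (p, q) = (2, 0)) → L ≤ 2 * n) ∧
    (((p, q) = (1, 0) ∨ (p, q) = (2, 1) ∨ (p, q) = (3, 2) ∨ (p, q) = (4, 3)) →
      L ≤ 2 * n + 2) := by
  subst hb
  refine ⟨fun hpq => ?_, ?_⟩
  · rcases L with _ | m
    · rfl
    · rw [Function.iterate_succ_apply'] at hL
      have hN : 0 < 2 ^ n := by positivity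
      have := ne_and_not_odd_of_Kpair_eq_mul_two_pow (by omega)
        (isDiffPair_iterate_Kpair (by omega) huv m) (hmin m (Nat.lt_succ_self m)) hL
      rw [Prod.mk.injEq] at hpq
      omega
  rcases typeA_or_exists_last huv hmin
    with ⟨hle, -⟩ | ⟨s, k, rfl, hk, hlt, -, -, e, hs, hA⟩
  · refine ⟨fun _ => hle, fun _ => by omega, fun _ => by omega⟩
  rw [e] at hL
  have hkn : k = n := by
    by_contra hne
    have hlt' : k < n := by omega
    refine not_two_pow_succ_dvd_iterate_Kpair hlt' hs hlt hA ?_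
    rw [hL]
    exact ⟨(pow_dvd_pow 2 hlt').mul_left p, (pow_dvd_pow 2 hlt').mul_left q⟩
  subst hkn
  rcases hs with hs | hs
  · have hend := typeB_end (by omega) hs hA hL
    have hs := typeB_time_lt hn huv (fun t ht => hmin t (by omega)) hs
    simp only [ne_eq, Prod.mk.injEq] at hend ⊢
    omega
  · have hend := typeC_end (by omega) hs hlt hA hL
    have hs := typeC_time_le huv (fun t ht => hmin t (by omega)) hs
    simp only [ne_eq, Prod.mk.injEq] at hend ⊢
    omega
end
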